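/- arXiv:2206.05996 — 13 statements merged into one kernel-verified Lean document; each statement's English description precedes it below -/
import Mathlib

section
/- Let φ be a real semiflow. Then for every fixed t ≥ 0 the map s ↦ φ_t(s) is increasing: if s₁ ≤ s₂ then φ_t(s₁) ≤ φ_t(s₂). -/
open Set Filter Topology

/-- For a real semiflow `φ`, for every fixed `t ≥ 0` the map `s ↦ φ t s`
is increasing. -/
theorem realSemiflow_increasing_in_space
    (φ : ℝ → ℝ → ℝ)
    (hcont : ContinuousOn (fun p : ℝ × ℝ => φ p.1 p.2) {p : ℝ × ℝ | 0 ≤ p.1})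
    (h0 : ∀ s : ℝ, φ 0 s = s)
    (hsemi : ∀ t τ s : ℝ, 0 ≤ t → 0 ≤ τ → φ t (φ τ s) = φ (t + τ) s)
    (hle : ∀ t s : ℝ, 0 ≤ t → φ t s ≤ s) :
    ∀ t : ℝ, 0 ≤ t → ∀ s₁ s₂ : ℝ, s₁ ≤ s₂ → φ t s₁ ≤ φ t s₂ := by
  intro t ht s₁ s₂ hs
  by_contra! hlt
  have horbit : ∀ s : ℝ, ContinuousOn (fun τ => φ τ s) (Icc 0 t) := fun s =>
    hcont.comp (f := fun τ : ℝ => (τ, s)) (by fun_prop) fun τ hτ => hτ.1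
  obtain ⟨τ, hτ, heq⟩ : ∃ τ ∈ Icc 0 t, φ τ s₂ - φ τ s₁ = 0 :=
    intermediate_value_Icc' ht ((horbit s₂).sub (horbit s₁))
      ⟨(sub_neg.2 hlt).le, by simpa [h0] using hs⟩
  have hsplit : ∀ s : ℝ, φ t s = φ (t - τ) (φ τ s) := fun s => by
    rw [hsemi _ _ _ (sub_nonneg.2 hτ.2) hτ.1, sub_add_cancel]
  rw [hsplit s₁, hsplit s₂, sub_eq_zero.1 heq] at hlt
  exact lt_irrefl _ hlt
end

section
/- Let φ be a real semiflow and s ∈ ℝ such that ω(s) ∈ ℝ, i.e., the set {φ_t(s) : t ≥ 0} is bounded below. Then ω(τ) ∈ ℝ for every τ ≥ s, and the function ω : [s,∞) → ℝ, ω(τ) = inf_{t≥0} φ_t(τ), is right continuous at s: ω(τ) → ω(s) as τ → s⁺. -/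
open Set Filter Topology

/-- The time-`t` maps of a continuous semiflow on the real line are monotone: two orbits cannot
cross, since they coincide from their first common time on. -/
theorem semiflow_monotone
    {φ : ℝ → ℝ → ℝ}
    (hcont : ContinuousOn (fun p : ℝ × ℝ => φ p.1 p.2) {p : ℝ × ℝ | 0 ≤ p.1})
    (h0 : ∀ s : ℝ, φ 0 s = s)
    (hsemi : ∀ t τ s : ℝ, 0 ≤ t → 0 ≤ τ → φ t (φ τ s) = φ (t + τ) s)
    {t : ℝ} (ht : 0 ≤ t) : Monotone (φ t) := by
  intro a b hab
  by_contra! hlt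
  have horbit (x : ℝ) : ContinuousOn (fun r => φ r x) (Icc 0 t) :=
    hcont.comp (f := fun r : ℝ => (r, x)) (by fun_prop) fun r hr => hr.1
  obtain ⟨r, hr, hrz⟩ := intermediate_value_Icc' ht ((horbit b).sub (horbit a))
    (show (0 : ℝ) ∈ _ from ⟨sub_nonpos.2 hlt.le,
      sub_nonneg.2 (by simpa only [h0] using hab)⟩)
  have heq : φ r b = φ r a := sub_eq_zero.mp hrz
  have hb := hsemi (t - r) r b (sub_nonneg.2 hr.2) hr.1
  have ha := hsemi (t - r) r a (sub_nonneg.2 hr.2) hr.1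
  rw [sub_add_cancel] at ha hb
  rw [← ha, ← hb, heq] at hlt
  exact lt_irrefl _ hlt

/-- For a real semiflow `φ` and `s ∈ ℝ` with `ω(s) ∈ ℝ` (the orbit of `s`
is bounded below), we have `ω(τ) ∈ ℝ` for every `τ ≥ s`, and
`ω(τ) = inf_{t ≥ 0} φ t τ` is right continuous at `s`. -/
theorem realSemiflow_omega_right_continuous
    (φ : ℝ → ℝ → ℝ)
    (hcont : ContinuousOn (fun p : ℝ × ℝ => φ p.1 p.2) {p : ℝ × ℝ | 0 ≤ p.1})
    (h0 : ∀ s : ℝ, φ 0 s = s)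
    (hsemi : ∀ t τ s : ℝ, 0 ≤ t → 0 ≤ τ → φ t (φ τ s) = φ (t + τ) s)
    (hle : ∀ t s : ℝ, 0 ≤ t → φ t s ≤ s)
    (ω : ℝ → ℝ)
    (hω : ∀ τ : ℝ, ω τ = sInf {x : ℝ | ∃ t : ℝ, 0 ≤ t ∧ φ t τ = x})
    (s : ℝ)
    (hs : BddBelow {x : ℝ | ∃ t : ℝ, 0 ≤ t ∧ φ t s = x}) :
    (∀ τ : ℝ, s ≤ τ → BddBelow {x : ℝ | ∃ t : ℝ, 0 ≤ t ∧ φ t τ = x}) ∧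
      Tendsto ω (𝓝[>] s) (𝓝 (ω s)) := by
  have hbdd (τ : ℝ) (hτ : s ≤ τ) : BddBelow {x : ℝ | ∃ t : ℝ, 0 ≤ t ∧ φ t τ = x} := by
    obtain ⟨m, hm⟩ := hs
    refine ⟨m, ?_⟩
    rintro _ ⟨t, ht, rfl⟩
    exact (hm ⟨t, ht, rfl⟩).trans (semiflow_monotone hcont h0 hsemi ht hτ)
  have hne (τ : ℝ) : {x : ℝ | ∃ t : ℝ, 0 ≤ t ∧ φ t τ = x}.Nonempty := ⟨φ 0 τ, 0, le_rfl, rfl⟩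
  refine ⟨hbdd, tendsto_order.2 ⟨fun a ha => ?_, fun a ha => ?_⟩⟩
  · filter_upwards [self_mem_nhdsWithin] with τ hτ
    refine ha.trans_le ?_
    rw [hω s, hω τ]
    refine le_csInf (hne τ) ?_
    rintro _ ⟨t, ht, rfl⟩
    exact (csInf_le hs ⟨t, ht, rfl⟩).trans
      (semiflow_monotone hcont h0 hsemi ht (le_of_lt hτ))
  · rw [hω s] at ha
    obtain ⟨_, ⟨t, ht, rfl⟩, hta⟩ := exists_lt_of_csInf_lt (hne s) ha
    have hc : Continuous (φ t) :=
      hcont.comp_continuous (f := fun x : ℝ => (t, x)) (by fun_prop) fun _ => ht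
    filter_upwards [self_mem_nhdsWithin,
      nhdsWithin_le_nhds (hc.continuousAt.eventually_lt_const hta)] with τ hτ hlt
    rw [hω τ]
    exact (csInf_le (hbdd τ (le_of_lt hτ)) ⟨t, ht, rfl⟩).trans_lt hlt
end

section
/- Let φ be a non-degenerate real semiflow. Then for each fixed s ∈ ℝ the map t ↦ φ_t(s) is strictly decreasing on [0,∞), and for each fixed t ≥ 0 the map s ↦ φ_t(s) is strictly increasing on ℝ. -/
open Set Filter Topology

/-- For a non-degenerate real semiflow `φ`, for each fixed `s`
the map `t ↦ φ t s` is strictly decreasing on `[0, ∞)`, and for each fixed `t ≥ 0`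
the map `s ↦ φ t s` is strictly increasing on `ℝ`. -/
theorem realSemiflow_nondegenerate_strict_monotone
    (φ : ℝ → ℝ → ℝ)
    (hcont : ContinuousOn (fun p : ℝ × ℝ => φ p.1 p.2) {p : ℝ × ℝ | 0 ≤ p.1})
    (h0 : ∀ s : ℝ, φ 0 s = s)
    (hsemi : ∀ t τ s : ℝ, 0 ≤ t → 0 ≤ τ → φ t (φ τ s) = φ (t + τ) s)
    (hle : ∀ t s : ℝ, 0 ≤ t → φ t s ≤ s)
    (hnd : ∀ s : ℝ, ∃ t : ℝ, 0 < t ∧ φ t s ≠ s) :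
    (∀ s : ℝ, StrictAntiOn (fun t : ℝ => φ t s) (Ici (0 : ℝ))) ∧
      (∀ t : ℝ, 0 ≤ t → StrictMono (fun s : ℝ => φ t s)) := by
  have anti : ∀ s a b : ℝ, 0 ≤ a → a ≤ b → φ b s ≤ φ a s := fun s a b ha hab => by
    have h := hsemi (b - a) a s (sub_nonneg.2 hab) ha
    rw [sub_add_cancel] at h
    exact h ▸ hle _ _ (sub_nonneg.2 hab)
  have no_return : ∀ d x : ℝ, 0 < d → φ d x ≠ x := fun d x hd hx => by
    have iter : ∀ n : ℕ, φ (n * d) x = x := fun n => by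
      induction n with
      | zero => simpa using h0 x
      | succ n ih =>
        have h := hsemi d (n * d) x hd.le (by positivity)
        rw [ih, hx] at h
        rw [Nat.cast_succ, add_one_mul, add_comm]
        exact h.symm
    obtain ⟨t, ht, hne⟩ := hnd x
    obtain ⟨n, hn⟩ := Archimedean.arch t hd
    rw [nsmul_eq_mul] at hn
    exact hne (le_antisymm (hle t x ht.le) ((iter n).symm.trans_le (anti x t _ ht.le hn)))
  have strict : ∀ s : ℝ, StrictAntiOn (fun t : ℝ => φ t s) (Ici (0 : ℝ)) := by
    intro s a ha b hb hab
    refine lt_of_le_of_ne (anti s a b ha hab.le) fun h => ?_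
    refine no_return (b - a) (φ a s) (sub_pos.2 hab) ?_
    rw [hsemi _ _ _ (sub_pos.2 hab).le ha, sub_add_cancel]
    exact h
  have cont_time : ∀ s : ℝ, ContinuousOn (fun t => φ t s) (Ici 0) := fun s =>
    hcont.comp (f := fun t : ℝ => (t, s)) (by fun_prop) fun t ht => ht
  have cont_space : ∀ t : ℝ, 0 ≤ t → Continuous (φ t) := fun t ht =>
    hcont.comp_continuous (f := fun s : ℝ => (t, s)) (by fun_prop) fun _ => ht
  have unbounded : ∀ s c : ℝ, ∃ t : ℝ, 0 ≤ t ∧ φ t s ≤ c := by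
    intro s c
    by_contra! hc
    have hg : Antitone fun t : ℝ => φ (max t 0) s := fun a b hab =>
      anti s _ _ (le_max_right _ _) (max_le_max_right 0 hab)
    have hlim := tendsto_atTop_ciInf hg
      ⟨c, by rintro _ ⟨t, rfl⟩; exact (hc _ (le_max_right _ _)).le⟩
    set L := ⨅ t : ℝ, φ (max t 0) s
    have h1 := ((cont_space 1 zero_le_one).tendsto L).comp hlim
    have h2 := hlim.comp (tendsto_atTop_add_const_left atTop (1 : ℝ) tendsto_id)
    refine no_return 1 L one_pos (tendsto_nhds_unique h1 (h2.congr' ?_))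
    filter_upwards [eventually_ge_atTop 0] with t ht
    simp only [Function.comp_apply, id]
    rw [max_eq_left ht, max_eq_left (by linarith), hsemi 1 t s zero_le_one ht]
  refine ⟨strict, fun t ht x y hxy => ?_⟩
  obtain ⟨b, hb, hbx⟩ := unbounded y x
  obtain ⟨T, hT, hTx⟩ := intermediate_value_Icc' hb
    ((cont_time y).mono Icc_subset_Ici_self) ⟨hbx, (h0 y).symm ▸ hxy.le⟩
  have hTx : φ T y = x := hTx
  have hTpos : 0 < T := lt_of_le_of_ne hT.1 fun h => by
    rw [← h, h0] at hTx
    exact hxy.ne' hTx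
  change φ t x < φ t y
  rw [← hTx, hsemi t T y ht hT.1]
  exact strict y ht (add_nonneg ht hT.1) (by linarith)
end

section
/- If φ : [0,∞) × ℝ → ℝ is a non-degenerate real semiflow, then there exists a continuous, strictly increasing function μ : ℝ → ℝ with μ(s) → −∞ as s → −∞ such that μ(φ_t(s)) = μ(s) − t for all t ≥ 0 and s ∈ ℝ (equivalently, φ_t(s) = μ⁻¹(μ(s) − t), where μ⁻¹ is the inverse of μ onto its range). -/
open Set Filter Topology

namespace RealSemiflow

/-- The orbits of a real semiflow are antitone in time. -/
lemma orbit_antitone {φ : ℝ → ℝ → ℝ}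
    (hsemi : ∀ t τ s : ℝ, 0 ≤ t → 0 ≤ τ → φ t (φ τ s) = φ (t + τ) s)
    (hle : ∀ t s : ℝ, 0 ≤ t → φ t s ≤ s)
    {t u : ℝ} (s : ℝ) (ht : 0 ≤ t) (htu : t ≤ u) : φ u s ≤ φ t s := by
  have h := hle (u - t) (φ t s) (sub_nonneg.2 htu)
  rwa [hsemi _ _ _ (sub_nonneg.2 htu) ht, sub_add_cancel] at h

/-- A non-degenerate real semiflow has no periodic points. -/
lemma ne_self {φ : ℝ → ℝ → ℝ} (h0 : ∀ s : ℝ, φ 0 s = s)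
    (hsemi : ∀ t τ s : ℝ, 0 ≤ t → 0 ≤ τ → φ t (φ τ s) = φ (t + τ) s)
    (hle : ∀ t s : ℝ, 0 ≤ t → φ t s ≤ s)
    (hnd : ∀ s : ℝ, ∃ t : ℝ, 0 < t ∧ φ t s ≠ s)
    {h : ℝ} (hh : 0 < h) (s : ℝ) : φ h s ≠ s := by
  intro hs
  have hiter : ∀ n : ℕ, φ (n * h) s = s := by
    intro n
    induction n with
    | zero => simp [h0]
    | succ n ih =>
      have hnh : 0 ≤ (n : ℝ) * h := by positivity
      rw [Nat.cast_succ, add_one_mul, ← hsemi _ _ _ hnh hh.le, hs, ih]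
  obtain ⟨t, ht, hts⟩ := hnd s
  obtain ⟨n, hn⟩ := exists_nat_ge (t / h)
  have hanti := orbit_antitone hsemi hle s ht.le ((div_le_iff₀ hh).1 hn)
  rw [hiter] at hanti
  exact hts (le_antisymm (hle t s ht.le) hanti)

/-- The orbits of a non-degenerate real semiflow are injective in time. -/
lemma orbit_injOn {φ : ℝ → ℝ → ℝ} (h0 : ∀ s : ℝ, φ 0 s = s)
    (hsemi : ∀ t τ s : ℝ, 0 ≤ t → 0 ≤ τ → φ t (φ τ s) = φ (t + τ) s)
    (hle : ∀ t s : ℝ, 0 ≤ t → φ t s ≤ s)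
    (hnd : ∀ s : ℝ, ∃ t : ℝ, 0 < t ∧ φ t s ≠ s) (s : ℝ) :
    InjOn (fun t => φ t s) (Ici 0) := by
  have key : ∀ {t u : ℝ}, 0 ≤ t → t < u → φ t s ≠ φ u s := by
    intro t u ht htu h
    refine ne_self h0 hsemi hle hnd (sub_pos.2 htu) (φ t s) ?_
    rw [hsemi _ _ _ (sub_pos.2 htu).le ht, sub_add_cancel, h]
  intro t ht u hu h
  rcases lt_trichotomy t u with htu | rfl | htu
  · exact absurd h (key ht htu)
  · rfl
  · exact absurd h.symm (key hu htu)

/-- The orbits of a non-degenerate real semiflow reach every lower point. -/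
lemma exists_eq_of_le {φ : ℝ → ℝ → ℝ}
    (hcont : ContinuousOn (fun p : ℝ × ℝ => φ p.1 p.2) {p : ℝ × ℝ | 0 ≤ p.1})
    (h0 : ∀ s : ℝ, φ 0 s = s)
    (hsemi : ∀ t τ s : ℝ, 0 ≤ t → 0 ≤ τ → φ t (φ τ s) = φ (t + τ) s)
    (hle : ∀ t s : ℝ, 0 ≤ t → φ t s ≤ s)
    (hnd : ∀ s : ℝ, ∃ t : ℝ, 0 < t ∧ φ t s ≠ s)
    {a b : ℝ} (hba : b ≤ a) : ∃ t, 0 ≤ t ∧ φ t a = b := by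
  obtain ⟨n, hn⟩ : ∃ n : ℕ, φ n a ≤ b := by
    by_contra! hlt
    have hanti : Antitone fun n : ℕ => φ n a := fun m n hmn =>
      orbit_antitone hsemi hle a m.cast_nonneg (Nat.cast_le.2 hmn)
    have hlim := tendsto_atTop_ciInf hanti ⟨b, by rintro _ ⟨n, rfl⟩; exact (hlt n).le⟩
    set L := ⨅ n : ℕ, φ n a
    have hφ : Continuous (φ 1) := by
      refine continuousOn_univ.1 (hcont.comp (f := fun s : ℝ => ((1 : ℝ), s)) (by fun_prop) ?_)
      intro s _
      exact zero_le_one (α := ℝ)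
    have hstep : ∀ n : ℕ, φ 1 (φ n a) = φ ((n + 1 : ℕ) : ℝ) a := fun n => by
      rw [hsemi _ _ _ zero_le_one n.cast_nonneg, Nat.cast_succ, add_comm]
    refine ne_self h0 hsemi hle hnd one_pos L
      (tendsto_nhds_unique ((hφ.tendsto L).comp hlim) ?_)
    exact ((tendsto_add_atTop_iff_nat 1).2 hlim).congr fun n => (hstep n).symm
  have hcts : ContinuousOn (fun t => φ t a) (Icc 0 n) :=
    hcont.comp (f := fun t : ℝ => (t, a)) (by fun_prop) fun t ht => ht.1
  obtain ⟨t, ht, hta⟩ :=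
    intermediate_value_Icc' n.cast_nonneg hcts ⟨hn, by simpa only [h0] using hba⟩
  exact ⟨t, ht.1, hta⟩

end RealSemiflow

open RealSemiflow

/-- Every non-degenerate real semiflow `φ` is generated by a continuous,
strictly increasing function `μ : ℝ → ℝ` with `μ(s) → −∞` as `s → −∞`, in the sense
that `μ (φ t s) = μ s − t` for all `t ≥ 0` and `s ∈ ℝ` (equivalently
`φ t s = μ⁻¹(μ s − t)`). -/
theorem realSemiflow_nondegenerate_generated_by_mu
    (φ : ℝ → ℝ → ℝ)
    (hcont : ContinuousOn (fun p : ℝ × ℝ => φ p.1 p.2) {p : ℝ × ℝ | 0 ≤ p.1})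
    (h0 : ∀ s : ℝ, φ 0 s = s)
    (hsemi : ∀ t τ s : ℝ, 0 ≤ t → 0 ≤ τ → φ t (φ τ s) = φ (t + τ) s)
    (hle : ∀ t s : ℝ, 0 ≤ t → φ t s ≤ s)
    (hnd : ∀ s : ℝ, ∃ t : ℝ, 0 < t ∧ φ t s ≠ s) :
    ∃ μ : ℝ → ℝ, Continuous μ ∧ StrictMono μ ∧ Tendsto μ atBot atBot ∧
      ∀ t s : ℝ, 0 ≤ t → μ (φ t s) = μ s - t := by
  have hreach : ∀ {a b : ℝ}, b ≤ a → ∃ t, 0 ≤ t ∧ φ t a = b :=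
    exists_eq_of_le hcont h0 hsemi hle hnd
  have hmeet : ∀ s, ∃ t u : ℝ, 0 ≤ t ∧ 0 ≤ u ∧ φ t s = φ u 0 := by
    intro s
    rcases le_total s 0 with hs | hs
    · obtain ⟨u, hu, hus⟩ := hreach hs
      exact ⟨0, u, le_rfl, hu, by rw [h0, hus]⟩
    · obtain ⟨t, ht, hts⟩ := hreach hs
      exact ⟨t, 0, ht, le_rfl, by rw [h0, hts]⟩
  choose T U hT hU hTU using hmeet
  have hunique : ∀ {s t u : ℝ}, 0 ≤ t → 0 ≤ u → φ t s = φ u 0 → T s - U s = t - u := by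
    intro s t u ht hu h
    have heq : φ (t + U s) 0 = φ (T s + u) 0 := by
      rw [← hsemi _ _ _ ht (hU s), ← hTU, hsemi _ _ _ ht (hT s), add_comm,
        ← hsemi _ _ _ (hT s) ht, h, hsemi _ _ _ (hT s) hu]
    have := orbit_injOn h0 hsemi hle hnd 0 (add_nonneg ht (hU s)) (add_nonneg (hT s) hu) heq
    linarith
  let μ : ℝ → ℝ := fun s => T s - U s
  have hμ : ∀ t s : ℝ, 0 ≤ t → μ (φ t s) = μ s - t := by
    intro t s ht
    have h := hunique (add_nonneg (hT (φ t s)) ht) (hU (φ t s))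
      (by rw [← hsemi _ _ _ (hT _) ht]; exact hTU _)
    change T (φ t s) - U (φ t s) = T s - U s - t
    linarith
  have hmono : StrictMono μ := by
    intro a b hab
    obtain ⟨t, ht, rfl⟩ := hreach hab.le
    have htpos : t ≠ 0 := by
      rintro rfl
      exact hab.ne (h0 b)
    rw [hμ t b ht]
    exact sub_lt_self _ (lt_of_le_of_ne ht htpos.symm)
  have hlower : ∀ {s c : ℝ}, c ≤ μ s → ∃ a, μ a = c := fun {s c} hc =>
    ⟨φ (μ s - c) s, by rw [hμ _ _ (sub_nonneg.2 hc), sub_sub_cancel]⟩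
  refine ⟨μ, ?_, hmono, ?_, hμ⟩
  · refine continuous_iff_continuousAt.2 fun s =>
      (hmono.strictMonoOn univ).continuousAt_of_image_mem_nhds univ_mem ?_
    refine mem_of_superset (Iio_mem_nhds (hmono (lt_add_one s))) fun c hc => ?_
    rw [image_univ]
    exact hlower (le_of_lt hc)
  · refine tendsto_atBot_atBot.2 fun c => ?_
    obtain ⟨a, ha⟩ := hlower (min_le_left (μ 0) c)
    exact ⟨a, fun s hs => (hmono.monotone hs).trans (ha.trans_le (min_le_right _ _))⟩
end

section
/- Let φ be a real semiflow such that ω(s₀) ∈ ℝ for some s₀ ∈ ℝ (a degenerate semiflow). The following are equivalent: (i) ω is bounded above, i.e., there exists α ∈ ℝ such that inf_{t≥0} φ_t(s) ≤ α for every s ∈ ℝ; (ii) ω is constant in a neighborhood of +∞, i.e., there exist τ, c ∈ ℝ such that ω(s) = c for all s ≥ τ; (iii) there exist sequences t_n > 0 and s_n → +∞ such that the sequence (φ_{t_n}(s_n))_{n∈ℕ} is bounded above. -/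
open Set Filter Topology

/-- `ω(s) = lim_{t→∞} φ t s = inf_{t ≥ 0} φ t s`, as an element of `ℝ ∪ {−∞} ⊆ EReal`. -/
noncomputable def omegaE (φ : ℝ → ℝ → ℝ) (s : ℝ) : EReal :=
  ⨅ t : Set.Ici (0 : ℝ), ((φ t.1 s : ℝ) : EReal)

section RealSemiflow

variable {φ : ℝ → ℝ → ℝ}

theorem omegaE_le_apply {t : ℝ} (ht : 0 ≤ t) (s : ℝ) : omegaE φ s ≤ (φ t s : EReal) :=
  iInf_le (fun t : Set.Ici (0 : ℝ) => ((φ t.1 s : ℝ) : EReal)) ⟨t, ht⟩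

theorem exists_apply_lt_of_omegaE_lt {s a : ℝ} (h : omegaE φ s < (a : EReal)) :
    ∃ t, 0 ≤ t ∧ φ t s < a := by
  obtain ⟨⟨t, ht⟩, h⟩ := iInf_lt_iff.1 h
  exact ⟨t, ht, EReal.coe_lt_coe_iff.1 h⟩

theorem exists_orbit_eq
    (hcont : ContinuousOn (fun p : ℝ × ℝ => φ p.1 p.2) {p : ℝ × ℝ | 0 ≤ p.1})
    (h0 : ∀ s : ℝ, φ 0 s = s) {a r s : ℝ} (ha : 0 ≤ a) (har : φ a s ≤ r) (hrs : r ≤ s) :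
    ∃ b ∈ Icc 0 a, φ b s = r := by
  have hc : ContinuousOn (fun t => φ t s) (Icc 0 a) :=
    hcont.comp (f := fun t : ℝ => (t, s)) (by fun_prop) fun _ ht => ht.1
  exact intermediate_value_Icc' ha hc ⟨har, (h0 s).symm ▸ hrs⟩

theorem realSemiflow_monotone
    (hcont : ContinuousOn (fun p : ℝ × ℝ => φ p.1 p.2) {p : ℝ × ℝ | 0 ≤ p.1})
    (h0 : ∀ s : ℝ, φ 0 s = s)
    (hsemi : ∀ t τ s : ℝ, 0 ≤ t → 0 ≤ τ → φ t (φ τ s) = φ (t + τ) s)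
    (hle : ∀ t s : ℝ, 0 ≤ t → φ t s ≤ s) {t : ℝ} (ht : 0 ≤ t) : Monotone (φ t) := by
  intro r s hrs
  by_contra! h
  obtain ⟨b, ⟨hb0, hbt⟩, hb⟩ := exists_orbit_eq hcont h0 ht (h.le.trans (hle t r ht)) hrs
  have h₁ := hsemi (t - b) b s (sub_nonneg.2 hbt) hb0
  have h₂ := hsemi b (t - b) r hb0 (sub_nonneg.2 hbt)
  rw [sub_add_cancel, hb] at h₁
  rw [add_sub_cancel] at h₂
  have h₃ := hle b (φ (t - b) r) hb0
  linarith

theorem omegaE_monotone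
    (hcont : ContinuousOn (fun p : ℝ × ℝ => φ p.1 p.2) {p : ℝ × ℝ | 0 ≤ p.1})
    (h0 : ∀ s : ℝ, φ 0 s = s)
    (hsemi : ∀ t τ s : ℝ, 0 ≤ t → 0 ≤ τ → φ t (φ τ s) = φ (t + τ) s)
    (hle : ∀ t s : ℝ, 0 ≤ t → φ t s ≤ s) : Monotone (omegaE φ) := fun _ _ hrs =>
  iInf_mono fun t => EReal.coe_le_coe_iff.2 (realSemiflow_monotone hcont h0 hsemi hle t.2 hrs)

theorem omegaE_eq_of_omegaE_lt
    (hcont : ContinuousOn (fun p : ℝ × ℝ => φ p.1 p.2) {p : ℝ × ℝ | 0 ≤ p.1})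
    (h0 : ∀ s : ℝ, φ 0 s = s)
    (hsemi : ∀ t τ s : ℝ, 0 ≤ t → 0 ≤ τ → φ t (φ τ s) = φ (t + τ) s)
    (hle : ∀ t s : ℝ, 0 ≤ t → φ t s ≤ s) {r s : ℝ} (hlt : omegaE φ s < (r : EReal))
    (hrs : r ≤ s) : omegaE φ s = omegaE φ r := by
  refine le_antisymm (le_iInf fun t => ?_) (omegaE_monotone hcont h0 hsemi hle hrs)
  obtain ⟨a, ha, har⟩ := exists_apply_lt_of_omegaE_lt hlt
  obtain ⟨b, ⟨hb0, -⟩, rfl⟩ := exists_orbit_eq hcont h0 ha har.le hrs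
  rw [hsemi t.1 b s t.2 hb0]
  exact omegaE_le_apply (add_nonneg t.2 hb0) s

end RealSemiflow

/-- For a degenerate real semiflow `φ` (i.e., `ω(s₀) ∈ ℝ` for some `s₀`),
the following are equivalent:
(i) `ω` is bounded above;
(ii) `ω` is constant in a neighborhood of `+∞`;
(iii) there exist sequences `t_n > 0`, `s_n → +∞` with `(φ (t_n) (s_n))_n` bounded above. -/
theorem degenerate_realSemiflow_omega_tfae
    (φ : ℝ → ℝ → ℝ)
    (hcont : ContinuousOn (fun p : ℝ × ℝ => φ p.1 p.2) {p : ℝ × ℝ | 0 ≤ p.1})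
    (h0 : ∀ s : ℝ, φ 0 s = s)
    (hsemi : ∀ t τ s : ℝ, 0 ≤ t → 0 ≤ τ → φ t (φ τ s) = φ (t + τ) s)
    (hle : ∀ t s : ℝ, 0 ≤ t → φ t s ≤ s)
    (hdeg : ∃ s₀ : ℝ, ∃ c : ℝ, omegaE φ s₀ = (c : EReal)) :
    [ (∃ α : ℝ, ∀ s : ℝ, omegaE φ s ≤ (α : EReal)),
      (∃ τ : ℝ, ∃ c : ℝ, ∀ s : ℝ, τ ≤ s → omegaE φ s = (c : EReal)),
      (∃ t s : ℕ → ℝ, (∀ n : ℕ, 0 < t n) ∧ Tendsto s atTop atTop ∧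
        ∃ α : ℝ, ∀ n : ℕ, φ (t n) (s n) ≤ α) ].TFAE := by
  tfae_have 1 → 2 := by
    rintro ⟨α, hα⟩
    obtain ⟨s₀, c, hc⟩ := hdeg
    set τ := max (α + 1) s₀
    have hατ : (α : EReal) < (τ : EReal) :=
      EReal.coe_lt_coe_iff.2 ((lt_add_one α).trans_le (le_max_left _ _))
    have hbot : omegaE φ τ ≠ ⊥ := by
      have h := omegaE_monotone hcont h0 hsemi hle (le_max_right (α + 1) s₀)
      rw [hc] at h
      exact ((EReal.bot_lt_coe c).trans_le h).ne'
    have htop : omegaE φ τ ≠ ⊤ := ((hα τ).trans_lt (EReal.coe_lt_top α)).ne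
    refine ⟨τ, (omegaE φ τ).toReal, fun s hs => ?_⟩
    rw [EReal.coe_toReal htop hbot]
    exact omegaE_eq_of_omegaE_lt hcont h0 hsemi hle ((hα s).trans_lt hατ) hs
  tfae_have 2 → 3 := by
    rintro ⟨τ, c, hc⟩
    have h : ∀ n : ℕ, ∃ t, 0 ≤ t ∧ φ t (τ + n) < c + 1 := fun n =>
      exists_apply_lt_of_omegaE_lt <| by
        rw [hc _ (le_add_of_nonneg_right n.cast_nonneg)]
        exact EReal.coe_lt_coe_iff.2 (lt_add_one c)
    choose t ht0 ht using h
    refine ⟨fun n => 1 + t n, fun n => τ + n, fun n => by linarith [ht0 n],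
      tendsto_atTop_add_const_left _ τ tendsto_natCast_atTop_atTop, c + 1, fun n => ?_⟩
    rw [← hsemi 1 (t n) _ zero_le_one (ht0 n)]
    exact (hle 1 _ zero_le_one).trans (ht n).le
  tfae_have 3 → 1 := by
    rintro ⟨t, s, ht, hs, α, hα⟩
    refine ⟨α, fun r => ?_⟩
    obtain ⟨n, hn⟩ := (hs.eventually_ge_atTop r).exists
    exact (omegaE_le_apply (ht n).le r).trans <| EReal.coe_le_coe_iff.2 <|
      (realSemiflow_monotone hcont h0 hsemi hle (ht n).le hn).trans (hα n)
  tfae_finish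
end

section
/- Let X be a nontrivial Banach space, U an evolution family on X with U(t,s) ≠ 0 for all t > s, and φ : [0,∞) × ℝ → ℝ a continuous function with φ(t,s) ≤ s for all t ≥ 0 and s ∈ ℝ. Define (T_t u)(s) = U(s, φ(t,s)) u(φ(t,s)). If (T_0 u)(s) = u(s) and (T_t(T_τ u))(s) = (T_{t+τ} u)(s) for all u ∈ C₀(ℝ,X), all t, τ ≥ 0 and all s ∈ ℝ, then φ is a real semiflow: φ(0,s) = s and φ(t, φ(τ, s)) = φ(t+τ, s) for all t, τ ≥ 0 and s ∈ ℝ. -/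
open Set Filter Topology
open scoped ZeroAtInfty

/-- Continuous functions vanishing at infinity on the line separate points with prescribed value. -/
theorem exists_zeroAtInfty_eq_and_eq_zero {X : Type*} [NormedAddCommGroup X] [NormedSpace ℝ X]
    {a b : ℝ} (hab : a ≠ b) (x : X) : ∃ u : C₀(ℝ, X), u a = x ∧ u b = 0 := by
  obtain ⟨f, hfa, hfb, hfc, -⟩ := exists_continuous_one_zero_of_isCompact
    (isCompact_singleton (x := a)) (isClosed_singleton (x := b)) (by simpa using hab)
  have hfa' : f a = 1 := hfa rfl
  have hfb' : f b = 0 := hfb rfl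
  have hsupp : HasCompactSupport (fun r => f r • x) := hfc.smul_right
  refine ⟨⟨⟨fun r => f r • x, by fun_prop⟩, hsupp.is_zero_at_infty⟩, ?_, ?_⟩
  · change f a • x = x
    rw [hfa', one_smul]
  · change f b • x = 0
    rw [hfb', zero_smul]

/-- Let `X` be a nontrivial Banach space, `U` an evolution family on `X`
with `U t s ≠ 0` for `t > s`, and `φ : [0,∞) × ℝ → ℝ` continuous with `φ t s ≤ s`.
Define `(T_t u)(s) = U(s, φ t s) (u (φ t s))`. If `T_0 u = u` and `T_t (T_τ u) = T_{t+τ} u`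
pointwise for all `u ∈ C₀(ℝ, X)` and `t, τ ≥ 0`, then `φ` is a real semiflow:
`φ 0 s = s` and `φ t (φ τ s) = φ (t+τ) s`. -/
theorem semigroup_law_implies_realSemiflow
    (X : Type*) [NormedAddCommGroup X] [NormedSpace ℝ X] [CompleteSpace X] [Nontrivial X]
    (U : ℝ → ℝ → (X →L[ℝ] X))
    (hU1 : ∀ t : ℝ, U t t = ContinuousLinearMap.id ℝ X)
    (hU2 : ∀ t τ s : ℝ, s ≤ τ → τ ≤ t → (U t τ).comp (U τ s) = U t s)
    (hU3 : ∀ x : X, ContinuousOn (fun p : ℝ × ℝ => U p.1 p.2 x) {p : ℝ × ℝ | p.2 ≤ p.1})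
    (hUne : ∀ t s : ℝ, s < t → U t s ≠ 0)
    (φ : ℝ → ℝ → ℝ)
    (hφcont : ContinuousOn (fun p : ℝ × ℝ => φ p.1 p.2) {p : ℝ × ℝ | 0 ≤ p.1})
    (hφle : ∀ t s : ℝ, 0 ≤ t → φ t s ≤ s)
    (hT0 : ∀ u : C₀(ℝ, X), ∀ s : ℝ, U s (φ 0 s) (u (φ 0 s)) = u s)
    (hTsemi : ∀ u : C₀(ℝ, X), ∀ t τ s : ℝ, 0 ≤ t → 0 ≤ τ →
      U s (φ t s) (U (φ t s) (φ τ (φ t s)) (u (φ τ (φ t s)))) =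
        U s (φ (t + τ) s) (u (φ (t + τ) s))) :
    (∀ s : ℝ, φ 0 s = s) ∧
      (∀ t τ s : ℝ, 0 ≤ t → 0 ≤ τ → φ t (φ τ s) = φ (t + τ) s) := by
  refine ⟨fun s => ?_, fun t τ s ht hτ => ?_⟩
  · by_contra hne
    obtain ⟨x, hx⟩ := exists_ne (0 : X)
    obtain ⟨u, hus, hu0⟩ := exists_zeroAtInfty_eq_and_eq_zero (Ne.symm hne) x
    have h := hT0 u s
    rw [hus, hu0, map_zero] at h
    exact hx h.symm
  · by_contra hne
    have hτs := hφle τ s hτ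
    have hts := hφle t (φ τ s) ht
    have hzero : U s (φ t (φ τ s)) = 0 := by
      ext x
      obtain ⟨u, hua, hub⟩ := exists_zeroAtInfty_eq_and_eq_zero hne x
      have h := hTsemi u τ t s hτ ht
      rw [add_comm τ t, hua, hub, map_zero] at h
      rw [← hU2 s (φ τ s) _ hts hτs]
      exact h
    rcases (hts.trans hτs).lt_or_eq with hlt | heq
    · exact hUne _ _ hlt hzero
    · rw [heq, hU1] at hzero
      obtain ⟨x, hx⟩ := exists_ne (0 : X)
      exact hx (congrArg (fun A : X →L[ℝ] X => A x) hzero)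
end

section
/- Let X be a Banach space, φ a real semiflow such that φ_t(s) → +∞ as s → +∞ for every t ≥ 0 (as holds when φ is non-degenerate with lim_{s→∞} φ_t(s) = +∞, or when lim_{s→∞} ω(s) = +∞), and U an evolution family on X such that ‖U(s, φ_t(s))‖ ≤ K e^{αt} for all t ≥ 0 and s ∈ ℝ, for some constants α > 0 and K ≥ 1. Then the operators (T_t u)(s) = U(s, φ_t(s)) u(φ_t(s)) form a C₀-semigroup on C₀(ℝ,X): (a) for each t ≥ 0 and u ∈ C₀(ℝ,X) one has T_t u ∈ C₀(ℝ,X) and T_t is a bounded linear operator on C₀(ℝ,X) with ‖T_t u‖_∞ ≤ K e^{αt} ‖u‖_∞; (b) T_0 = Id and T_t ∘ T_τ = T_{t+τ} for all t, τ ≥ 0; (c) ‖T_t u − u‖_∞ → 0 as t → 0⁺ for every u ∈ C₀(ℝ,X). -/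
open Set Filter Topology
open scoped ZeroAtInfty

/-- Pointwise application of a strongly continuous, bounded operator family to a continuous
vector-valued function is continuous. -/
theorem ContinuousOn.clm_apply_of_bounded {Y X Z : Type*} [TopologicalSpace Y]
    [NormedAddCommGroup X] [NormedSpace ℝ X] [NormedAddCommGroup Z] [NormedSpace ℝ Z]
    {S : Set Y} {A : Y → (X →L[ℝ] Z)} {v : Y → X} {B : Y → ℝ}
    (hA : ∀ x, ContinuousOn (fun y => A y x) S) (hv : ContinuousOn v S)
    (hB : ContinuousOn B S) (hAB : ∀ y ∈ S, ‖A y‖ ≤ B y) :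
    ContinuousOn (fun y => A y (v y)) S := by
  intro y₀ hy₀
  have hfirst : Tendsto (fun y => A y (v y - v y₀)) (𝓝[S] y₀) (𝓝 0) := by
    have hlim : Tendsto (fun y => B y * ‖v y - v y₀‖) (𝓝[S] y₀) (𝓝 0) := by
      have := (hB y₀ hy₀).tendsto.mul ((hv y₀ hy₀).tendsto.sub_const (v y₀)).norm
      simpa using this
    refine squeeze_zero_norm' ?_ hlim
    filter_upwards [self_mem_nhdsWithin] with y hy
    exact (A y).le_of_opNorm_le (hAB y hy) _
  have := hfirst.add (hA (v y₀) y₀ hy₀)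
  simpa [ContinuousWithinAt] using this

namespace ZeroAtInftyContinuousMap

theorem norm_apply_le {X : Type*} [NormedAddCommGroup X] (u : C₀(ℝ, X)) (s : ℝ) :
    ‖u s‖ ≤ ‖u‖ :=
  u.toBCF.norm_coe_le_norm s

theorem norm_le_of_forall {X : Type*} [NormedAddCommGroup X] {u : C₀(ℝ, X)} {C : ℝ}
    (hC : 0 ≤ C) (h : ∀ s, ‖u s‖ ≤ C) : ‖u‖ ≤ C :=
  (BoundedContinuousFunction.norm_le (f := u.toBCF) hC).2 h

/-- A uniformly bounded, strongly continuous family of operators and a proper map define a bounded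
weighted composition operator on `C₀(ℝ, X)`. -/
theorem exists_weighted_composition {X : Type*} [NormedAddCommGroup X] [NormedSpace ℝ X]
    {A : ℝ → (X →L[ℝ] X)} {ψ : ℝ → ℝ} {C : ℝ} (hA : ∀ x, Continuous fun s => A s x)
    (hψ : Continuous ψ) (hψ' : Tendsto ψ (cocompact ℝ) (cocompact ℝ)) (hC : 0 ≤ C)
    (hAC : ∀ s, ‖A s‖ ≤ C) :
    ∃ T : C₀(ℝ, X) →L[ℝ] C₀(ℝ, X),
      (∀ u s, T u s = A s (u (ψ s))) ∧ ∀ u, ‖T u‖ ≤ C * ‖u‖ := by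
  let L : C₀(ℝ, X) →ₗ[ℝ] C₀(ℝ, X) :=
    { toFun := fun u =>
        { toFun := fun s => A s (u (ψ s))
          continuous_toFun := by
            have := ContinuousOn.clm_apply_of_bounded (S := univ) (B := fun _ => C)
              (fun x => (hA x).continuousOn) (u.continuous.comp hψ).continuousOn
              continuousOn_const (fun s _ => hAC s)
            exact continuousOn_univ.1 this
          zero_at_infty' := by
            have hlim : Tendsto (fun s => C * ‖u (ψ s)‖) (cocompact ℝ) (𝓝 0) := by
              simpa using ((u.zero_at_infty'.comp hψ').norm.const_mul C)
            exact squeeze_zero_norm (fun s => (A s).le_of_opNorm_le (hAC s) _) hlim }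
      map_add' := fun u v => by ext s; exact map_add (A s) _ _
      map_smul' := fun c u => by ext s; exact map_smul (A s) c _ }
  have hL : ∀ u, ‖L u‖ ≤ C * ‖u‖ := fun u =>
    norm_le_of_forall (by positivity) fun s =>
      ((A s).le_of_opNorm_le (hAC s) _).trans (by gcongr; exact norm_apply_le u _)
  exact ⟨L.mkContinuous C hL, fun _ _ => rfl, hL⟩

end ZeroAtInftyContinuousMap

/-- Let `X` be a Banach space, `φ` a real semiflow with `φ t s → +∞` as
`s → +∞` for every `t ≥ 0`, and `U` an evolution family with
`‖U(s, φ t s)‖ ≤ K e^{αt}` for all `t ≥ 0`, `s ∈ ℝ` (`α > 0`, `K ≥ 1`). Then the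
operators `(T_t u)(s) = U(s, φ t s) (u (φ t s))` form a `C₀`-semigroup on `C₀(ℝ, X)`:
each `T_t` is bounded linear from `C₀(ℝ, X)` to itself with
`‖T_t u‖ ≤ K e^{αt} ‖u‖`, `T_0 = Id`, `T_t ∘ T_τ = T_{t+τ}`, and
`‖T_t u − u‖ → 0` as `t → 0⁺`. -/
theorem generalized_evolution_semigroup_is_C0
    (X : Type*) [NormedAddCommGroup X] [NormedSpace ℝ X] [CompleteSpace X]
    (φ : ℝ → ℝ → ℝ)
    (hcont : ContinuousOn (fun p : ℝ × ℝ => φ p.1 p.2) {p : ℝ × ℝ | 0 ≤ p.1})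
    (h0 : ∀ s : ℝ, φ 0 s = s)
    (hsemi : ∀ t τ s : ℝ, 0 ≤ t → 0 ≤ τ → φ t (φ τ s) = φ (t + τ) s)
    (hle : ∀ t s : ℝ, 0 ≤ t → φ t s ≤ s)
    (hφtop : ∀ t : ℝ, 0 ≤ t → Tendsto (fun s : ℝ => φ t s) atTop atTop)
    (U : ℝ → ℝ → (X →L[ℝ] X))
    (hU1 : ∀ t : ℝ, U t t = ContinuousLinearMap.id ℝ X)
    (hU2 : ∀ t τ s : ℝ, s ≤ τ → τ ≤ t → (U t τ).comp (U τ s) = U t s)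
    (hU3 : ∀ x : X, ContinuousOn (fun p : ℝ × ℝ => U p.1 p.2 x) {p : ℝ × ℝ | p.2 ≤ p.1})
    (K α : ℝ) (hα : 0 < α) (hK : 1 ≤ K)
    (hbound : ∀ t s : ℝ, 0 ≤ t → ‖U s (φ t s)‖ ≤ K * Real.exp (α * t)) :
    ∃ T : ℝ → (C₀(ℝ, X) →L[ℝ] C₀(ℝ, X)),
      (∀ t : ℝ, 0 ≤ t → ∀ u : C₀(ℝ, X), ∀ s : ℝ,
        T t u s = U s (φ t s) (u (φ t s))) ∧
      (∀ t : ℝ, 0 ≤ t → ∀ u : C₀(ℝ, X), ‖T t u‖ ≤ K * Real.exp (α * t) * ‖u‖) ∧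
      (∀ u : C₀(ℝ, X), T 0 u = u) ∧
      (∀ t τ : ℝ, 0 ≤ t → 0 ≤ τ → ∀ u : C₀(ℝ, X), T t (T τ u) = T (t + τ) u) ∧
      (∀ u : C₀(ℝ, X), Tendsto (fun t : ℝ => ‖T t u - u‖) (𝓝[>] (0 : ℝ)) (𝓝 0)) := by
  have hmaps : ∀ p ∈ {p : ℝ × ℝ | 0 ≤ p.1}, (p.2, φ p.1 p.2) ∈ {q : ℝ × ℝ | q.2 ≤ q.1} :=
    fun p hp => hle p.1 p.2 hp
  have hA : ∀ x, ContinuousOn (fun p : ℝ × ℝ => U p.2 (φ p.1 p.2) x) {p | 0 ≤ p.1} :=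
    fun x => (hU3 x).comp (continuousOn_snd.prodMk hcont) hmaps
  have hφbot : ∀ t : ℝ, 0 ≤ t → Tendsto (φ t) atBot atBot := fun t ht =>
    tendsto_atBot_mono (fun s => hle t s ht) tendsto_id
  have hφcocompact : ∀ t : ℝ, 0 ≤ t → Tendsto (φ t) (cocompact ℝ) (cocompact ℝ) := by
    intro t ht
    rw [cocompact_eq_atBot_atTop]
    exact (hφbot t ht).sup_sup (hφtop t ht)
  have hex : ∀ t : ℝ, ∃ T : C₀(ℝ, X) →L[ℝ] C₀(ℝ, X), 0 ≤ t →
      (∀ u s, T u s = U s (φ t s) (u (φ t s))) ∧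
      ∀ u, ‖T u‖ ≤ K * Real.exp (α * t) * ‖u‖ := by
    intro t
    by_cases ht : 0 ≤ t
    · obtain ⟨T, hT⟩ := ZeroAtInftyContinuousMap.exists_weighted_composition
        (A := fun s => U s (φ t s)) (ψ := φ t) (C := K * Real.exp (α * t))
        (fun x => (hA x).comp_continuous (f := fun s => (t, s)) (by fun_prop) fun _ => ht)
        (hcont.comp_continuous (f := fun s => (t, s)) (by fun_prop) fun _ => ht)
        (hφcocompact t ht) (by positivity) (fun s => hbound t s ht)
      exact ⟨T, fun _ => hT⟩
    · exact ⟨0, fun h => absurd h ht⟩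
  choose T hT using hex
  have hTapply : ∀ t, 0 ≤ t → ∀ u s, T t u s = U s (φ t s) (u (φ t s)) :=
    fun t ht => (hT t ht).1
  refine ⟨T, hTapply, fun t ht => (hT t ht).2, ?_, ?_, ?_⟩
  · intro u
    ext s
    simp [hTapply 0 le_rfl, h0, hU1]
  · intro t τ ht hτ u
    ext s
    rw [hTapply t ht, hTapply τ hτ, hTapply (t + τ) (add_nonneg ht hτ), hsemi τ t s hτ ht,
      add_comm τ t, ← hU2 s (φ t s) (φ (t + τ) s) _ (hle t s ht)]
    · rfl
    · rw [add_comm t τ, ← hsemi τ t s hτ ht]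
      exact hle τ _ hτ
  · intro u
    have hjoint : ContinuousOn (fun p : ℝ × ℝ => U p.2 (φ p.1 p.2) (u (φ p.1 p.2)))
        {p | 0 ≤ p.1} :=
      ContinuousOn.clm_apply_of_bounded (B := fun p => K * Real.exp (α * p.1)) hA
        (u.continuous.comp_continuousOn hcont) (by fun_prop) (fun p hp => hbound p.1 p.2 hp)
    rw [Metric.tendsto_nhds]
    intro ε hε
    set C := K * Real.exp α
    have hC : 0 < C := by positivity
    set δ := min (ε / 4) (ε / (4 * C))
    have hδ : 0 < δ := by positivity
    have hu : ∀ᶠ s in atBot ⊔ atTop, ‖u s‖ < δ := by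
      rw [← cocompact_eq_atBot_atTop]
      simpa using (u.zero_at_infty'.norm).eventually (gt_mem_nhds (by simpa using hδ))
    obtain ⟨hubot, hutop⟩ := eventually_sup.1 hu
    obtain ⟨a, ha⟩ := eventually_atBot.1 hubot
    obtain ⟨N, hN⟩ := eventually_atTop.1 hutop
    obtain ⟨b, hb⟩ := eventually_atTop.1 ((hφtop 1 zero_le_one).eventually_ge_atTop N)
    obtain ⟨V, hV, hVε⟩ := (isCompact_Icc (a := a) (b := b)).mem_uniformity_of_prod
      (f := fun t s => U s (φ t s) (u (φ t s))) (s := Ici (0 : ℝ))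
      (hjoint.mono fun p hp => hp.1) (mem_Ici.2 le_rfl) (Metric.dist_mem_uniformity (half_pos hε))
    have hV' : V ∈ 𝓝[>] (0 : ℝ) := nhdsWithin_mono _ Ioi_subset_Ici_self hV
    filter_upwards [hV', Ioo_mem_nhdsGT zero_lt_one] with t htV ⟨ht0, ht1⟩
    have ht := ht0.le
    have htail : ∀ s, ‖u s‖ < δ → ‖u (φ t s)‖ < δ → ‖(T t u - u) s‖ ≤ ε / 2 := by
      intro s hs hφs
      have hop : ‖U s (φ t s)‖ ≤ C := (hbound t s ht).trans (by
        simp only [C]; gcongr; nlinarith)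
      have h1 : ‖T t u s‖ ≤ C * δ := by
        rw [hTapply t ht]
        exact ((U s (φ t s)).le_of_opNorm_le hop _).trans (by gcongr)
      have h2 : C * δ ≤ ε / 4 := by
        calc C * δ ≤ C * (ε / (4 * C)) := by gcongr; exact min_le_right _ _
          _ = ε / 4 := by field_simp
      have h3 : δ ≤ ε / 4 := min_le_left _ _
      rw [ZeroAtInftyContinuousMap.sub_apply]
      linarith [norm_sub_le (T t u s) (u s)]
    have hnorm : ‖T t u - u‖ ≤ ε / 2 := by
      refine ZeroAtInftyContinuousMap.norm_le_of_forall (by positivity) fun s => ?_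
      rcases le_total s a with hsa | hsa
      · exact htail s (ha s hsa) (ha _ ((hle t s ht).trans hsa))
      rcases le_total b s with hsb | hsb
      · have h1 : φ 1 s ≤ φ t s := by
          have := hsemi (1 - t) t s (by linarith) ht
          rw [sub_add_cancel] at this
          exact this ▸ hle (1 - t) _ (by linarith)
        exact htail s (hN s ((hb s hsb).trans (hle 1 s zero_le_one))) (hN _ ((hb s hsb).trans h1))
      · have := hVε t htV s ⟨hsa, hsb⟩
        simp only [h0, hU1, mem_ofPred_eq, dist_eq_norm, ContinuousLinearMap.id_apply] at this
        rw [ZeroAtInftyContinuousMap.sub_apply, hTapply t ht]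
        exact this.le
    simpa using hnorm.trans_lt (half_lt_self hε)
end

section
/- Let X be a Banach space, μ : ℝ → ℝ a continuous, strictly increasing function with μ(s) → −∞ as s → −∞ and μ(s) → +∞ as s → +∞ (hence a homeomorphism of ℝ with inverse μ⁻¹), and U an evolution family on X satisfying ‖U(s,τ)‖ ≤ K e^{α(μ(s)−μ(τ))} for all s ≥ τ, for some constants α > 0 and K ≥ 1. Then the operators (T_t u)(s) = U(s, μ⁻¹(μ(s)−t)) u(μ⁻¹(μ(s)−t)) form a C₀-semigroup on C₀(ℝ,X): each T_t is a bounded linear operator of C₀(ℝ,X) into itself with ‖T_t u‖_∞ ≤ K e^{αt} ‖u‖_∞, T_0 = Id, T_t ∘ T_τ = T_{t+τ} for all t, τ ≥ 0, and ‖T_t u − u‖_∞ → 0 as t → 0⁺ for every u ∈ C₀(ℝ,X). -/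
open Set Filter Topology
open scoped ZeroAtInfty

/-- Operators that are strongly continuous and locally bounded along a filter act jointly
continuously. -/
theorem tendsto_clm_apply_of_eventually_bounded {ι X : Type*} [NormedAddCommGroup X]
    [NormedSpace ℝ X] {l : Filter ι} {A : ι → X →L[ℝ] X} {v : ι → X} {x y : X} {M : ℝ}
    (hA : Tendsto (fun i => A i x) l (𝓝 y)) (hM : ∀ᶠ i in l, ‖A i‖ ≤ M)
    (hv : Tendsto v l (𝓝 x)) : Tendsto (fun i => A i (v i)) l (𝓝 y) := by
  have h0 : Tendsto (fun i => A i (v i - x)) l (𝓝 0) := by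
    refine squeeze_zero_norm' (a := fun i => M * ‖v i - x‖) ?_ ?_
    · filter_upwards [hM] with i hi
      exact (A i).le_of_opNorm_le hi _
    · simpa using (tendsto_iff_norm_sub_tendsto_zero.1 hv).const_mul M
  simpa using h0.add hA

theorem ZeroAtInftyContinuousMap.norm_le_of_forall_norm_le {α X : Type*} [TopologicalSpace α]
    [NormedAddCommGroup X] (f : C₀(α, X)) {C : ℝ} (hC : 0 ≤ C) (h : ∀ s, ‖f s‖ ≤ C) :
    ‖f‖ ≤ C := by
  rw [← ZeroAtInftyContinuousMap.norm_toBCF_eq_norm]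
  exact (BoundedContinuousFunction.norm_le hC).2 h

theorem ZeroAtInftyContinuousMap.norm_apply_le_s12 {α X : Type*} [TopologicalSpace α]
    [NormedAddCommGroup X] (f : C₀(α, X)) (s : α) : ‖f s‖ ≤ ‖f‖ := by
  rw [← ZeroAtInftyContinuousMap.norm_toBCF_eq_norm]
  exact f.toBCF.norm_coe_le_norm s

/-- A function in `C₀(ℝ, X)` is uniformly small outside a compact interval. -/
theorem ZeroAtInftyContinuousMap.exists_norm_lt_outside_Icc {X : Type*}
    [NormedAddCommGroup X] (u : C₀(ℝ, X)) {ε : ℝ} (hε : 0 < ε) :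
    ∃ a b : ℝ, ∀ s, s < a ∨ b < s → ‖u s‖ < ε := by
  have h : ∀ᶠ s in cocompact ℝ, ‖u s‖ < ε := by
    have := (zero_at_infty u).norm
    rw [norm_zero] at this
    exact this.eventually_lt_const hε
  rw [cocompact_eq_atBot_atTop, eventually_sup] at h
  obtain ⟨a, ha⟩ := eventually_atBot.1 h.1
  obtain ⟨b, hb⟩ := eventually_atTop.1 h.2
  exact ⟨a, b, fun s hs => hs.elim (fun h => ha s h.le) (fun h => hb s h.le)⟩

/-- Let `X` be a Banach space, `μ : ℝ → ℝ` a continuous, strictly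
increasing homeomorphism of `ℝ` (with `μ → −∞` at `−∞` and `μ → +∞` at `+∞`, inverse
`μinv`), and `U` an evolution family with `‖U s τ‖ ≤ K e^{α(μ s − μ τ)}` for `s ≥ τ`
(`α > 0`, `K ≥ 1`). Then the operators `(T_t u)(s) = U(s, μ⁻¹(μ s − t)) u(μ⁻¹(μ s − t))`
form a `C₀`-semigroup on `C₀(ℝ, X)`. -/
theorem generalized_evolution_semigroup_mu_is_C0
    (X : Type*) [NormedAddCommGroup X] [NormedSpace ℝ X] [CompleteSpace X]
    (μ μinv : ℝ → ℝ)
    (hμc : Continuous μ) (hμm : StrictMono μ)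
    (hμbot : Tendsto μ atBot atBot) (hμtop : Tendsto μ atTop atTop)
    (hinv₁ : ∀ s : ℝ, μinv (μ s) = s) (hinv₂ : ∀ s : ℝ, μ (μinv s) = s)
    (U : ℝ → ℝ → (X →L[ℝ] X))
    (hU1 : ∀ t : ℝ, U t t = ContinuousLinearMap.id ℝ X)
    (hU2 : ∀ t τ s : ℝ, s ≤ τ → τ ≤ t → (U t τ).comp (U τ s) = U t s)
    (hU3 : ∀ x : X, ContinuousOn (fun p : ℝ × ℝ => U p.1 p.2 x) {p : ℝ × ℝ | p.2 ≤ p.1})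
    (K α : ℝ) (hα : 0 < α) (hK : 1 ≤ K)
    (hbound : ∀ s τ : ℝ, τ ≤ s → ‖U s τ‖ ≤ K * Real.exp (α * (μ s - μ τ))) :
    ∃ T : ℝ → (C₀(ℝ, X) →L[ℝ] C₀(ℝ, X)),
      (∀ t : ℝ, 0 ≤ t → ∀ u : C₀(ℝ, X), ∀ s : ℝ,
        T t u s = U s (μinv (μ s - t)) (u (μinv (μ s - t)))) ∧
      (∀ t : ℝ, 0 ≤ t → ∀ u : C₀(ℝ, X), ‖T t u‖ ≤ K * Real.exp (α * t) * ‖u‖) ∧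
      (∀ u : C₀(ℝ, X), T 0 u = u) ∧
      (∀ t τ : ℝ, 0 ≤ t → 0 ≤ τ → ∀ u : C₀(ℝ, X), T t (T τ u) = T (t + τ) u) ∧
      (∀ u : C₀(ℝ, X), Tendsto (fun t : ℝ => ‖T t u - u‖) (𝓝[>] (0 : ℝ)) (𝓝 0)) := by
  have hK0 : 0 ≤ K := zero_le_one.trans hK
  let e : ℝ ≃o ℝ := StrictMono.orderIsoOfRightInverse μ hμm μinv hinv₂
  have hec : Continuous μinv := e.symm.continuous
  have him : StrictMono μinv := e.symm.strictMono
  have hibot : Tendsto μinv atBot atBot := e.symm.tendsto_atBot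
  have hitop : Tendsto μinv atTop atTop := e.symm.tendsto_atTop
  let σ : ℝ → ℝ → ℝ := fun t s => μinv (μ s - max t 0)
  have hσle : ∀ t s, σ t s ≤ s := fun t s => by
    calc σ t s ≤ μinv (μ s) := him.monotone (by linarith [le_max_right t 0])
      _ = s := hinv₁ s
  have hσc : Continuous fun p : ℝ × ℝ => σ p.1 p.2 :=
    hec.comp ((hμc.comp continuous_snd).sub (continuous_fst.max continuous_const))
  have hUb : ∀ t s, ‖U s (σ t s)‖ ≤ K * Real.exp (α * max t 0) := fun t s => by
    have h := hbound s (σ t s) (hσle t s)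
    rwa [hinv₂, sub_sub_cancel] at h
  have hGc : ∀ u : C₀(ℝ, X),
      Continuous fun p : ℝ × ℝ => U p.2 (σ p.1 p.2) (u (σ p.1 p.2)) := fun u => by
    rw [continuous_iff_continuousAt]
    intro p
    have hUs : Continuous fun q : ℝ × ℝ => U q.2 (σ q.1 q.2) (u (σ p.1 p.2)) :=
      (hU3 (u (σ p.1 p.2))).comp_continuous (continuous_snd.prodMk hσc)
        fun q => hσle q.1 q.2
    have hbd : ∀ᶠ q : ℝ × ℝ in 𝓝 p,
        ‖U q.2 (σ q.1 q.2)‖ ≤ K * Real.exp (α * max p.1 0) + 1 := by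
      have hc : Continuous fun q : ℝ × ℝ => K * Real.exp (α * max q.1 0) := by fun_prop
      filter_upwards [(hc.tendsto p).eventually_lt_const (lt_add_one _)] with q hq
      exact (hUb q.1 q.2).trans hq.le
    exact tendsto_clm_apply_of_eventually_bounded (hUs.tendsto p) hbd
      ((u.continuous.comp hσc).tendsto p)
  have hGb : ∀ (u : C₀(ℝ, X)) (t s : ℝ),
      ‖U s (σ t s) (u (σ t s))‖ ≤ K * Real.exp (α * max t 0) * ‖u (σ t s)‖ :=
    fun u t s => (U s (σ t s)).le_of_opNorm_le (hUb t s) _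
  have hσcoc : ∀ t, Tendsto (σ t) (cocompact ℝ) (cocompact ℝ) := fun t => by
    rw [cocompact_eq_atBot_atTop]
    exact Tendsto.sup_sup
      (hibot.comp (tendsto_atBot_add_const_right _ (-max t 0) hμbot))
      (hitop.comp (tendsto_atTop_add_const_right _ (-max t 0) hμtop))
  let S : ℝ → C₀(ℝ, X) → C₀(ℝ, X) := fun t u =>
    { toFun := fun s => U s (σ t s) (u (σ t s))
      continuous_toFun := (hGc u).comp (Continuous.prodMk_right t)
      zero_at_infty' := by
        refine squeeze_zero_norm (hGb u t) ?_
        have h := ((zero_at_infty u).comp (hσcoc t)).norm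
        rw [norm_zero] at h
        simpa using h.const_mul (K * Real.exp (α * max t 0)) }
  have hSn : ∀ t u, ‖S t u‖ ≤ K * Real.exp (α * max t 0) * ‖u‖ := fun t u =>
    (S t u).norm_le_of_forall_norm_le (by positivity) fun s =>
      (hGb u t s).trans (by gcongr; exact u.norm_apply_le_s12 _)
  let T : ℝ → (C₀(ℝ, X) →L[ℝ] C₀(ℝ, X)) := fun t =>
    LinearMap.mkContinuous
      { toFun := S t
        map_add' := fun u v => by ext s; exact map_add (U s (σ t s)) _ _
        map_smul' := fun c u => by ext s; exact map_smul (U s (σ t s)) c _ }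
      (K * Real.exp (α * max t 0)) (hSn t)
  have hT : ∀ t : ℝ, 0 ≤ t → ∀ u : C₀(ℝ, X), ∀ s : ℝ,
      T t u s = U s (μinv (μ s - t)) (u (μinv (μ s - t))) := fun t ht u s => by
    change U s (σ t s) (u (σ t s)) = _
    simp only [σ, max_eq_left ht]
  have hT0 : ∀ u : C₀(ℝ, X), T 0 u = u := fun u => by
    ext s
    rw [hT 0 le_rfl, sub_zero, hinv₁, hU1, ContinuousLinearMap.id_apply]
  refine ⟨T, hT, fun t ht u => ?_, hT0, fun t τ ht hτ u => ?_, fun u => ?_⟩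
  · have h := hSn t u
    rwa [max_eq_left ht] at h
  · ext s
    have h₁ : μinv (μ s - t) ≤ s := by simpa [σ, max_eq_left ht] using hσle t s
    have h₂ : μinv (μ s - (t + τ)) ≤ μinv (μ s - t) := him.monotone (by linarith)
    rw [hT t ht, hT τ hτ, hT (t + τ) (add_nonneg ht hτ), hinv₂, sub_sub,
      ← hU2 _ _ _ h₂ h₁, ContinuousLinearMap.comp_apply]
  · rw [Metric.tendsto_nhds]
    intro ε hε
    set M : ℝ := K * Real.exp α with hM
    have hM0 : 0 ≤ M := by positivity
    obtain ⟨a, b, hab⟩ := u.exists_norm_lt_outside_Icc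
      (show 0 < ε / (2 * (M + 1)) by positivity)
    have hcpt : ∀ᶠ t in 𝓝 (0 : ℝ), ∀ s ∈ Icc a (μinv (μ b + 1)),
        ‖U s (σ t s) (u (σ t s)) - u s‖ < ε / 2 := by
      refine isCompact_Icc.eventually_forall_of_forall_eventually fun s _ => ?_
      have hc : Continuous fun p : ℝ × ℝ =>
          ‖U p.2 (σ p.1 p.2) (u (σ p.1 p.2)) - u p.2‖ :=
        ((hGc u).sub (u.continuous.comp continuous_snd)).norm
      refine (hc.tendsto (0, s)).eventually_lt_const ?_
      have h : U s (σ 0 s) (u (σ 0 s)) = u s := DFunLike.congr_fun (hT0 u) s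
      simpa [h] using hε
    filter_upwards [nhdsWithin_le_nhds hcpt, self_mem_nhdsWithin,
      nhdsWithin_le_nhds (Iio_mem_nhds (zero_lt_one' ℝ))] with t htc ht0 ht1
    have ht0 : 0 < t := ht0
    have ht1 : t < 1 := ht1
    rw [dist_zero_right, norm_norm]
    refine lt_of_le_of_lt ?_ (half_lt_self hε)
    refine (T t u - u).norm_le_of_forall_norm_le (half_pos hε).le fun s => ?_
    change ‖U s (σ t s) (u (σ t s)) - u s‖ ≤ ε / 2
    by_cases hs : s ∈ Icc a (μinv (μ b + 1))
    · exact (htc s hs).le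
    have hout : (s < a ∨ b < s) ∧ (σ t s < a ∨ b < σ t s) := by
      rw [mem_Icc, not_and_or, not_le, not_le] at hs
      rcases hs with hs | hs
      · exact ⟨.inl hs, .inl ((hσle t s).trans_lt hs)⟩
      · have h₁ : μ b + 1 < μ s := by simpa [hinv₂] using hμm hs
        have h₂ : b < σ t s := by
          rw [← hμm.lt_iff_lt]
          simp only [σ, hinv₂, max_eq_left ht0.le]
          linarith
        exact ⟨.inr (h₂.trans_le (hσle t s)), .inr h₂⟩
    have hexp : K * Real.exp (α * max t 0) ≤ M := by
      rw [max_eq_left ht0.le, hM]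
      gcongr
      nlinarith
    calc ‖U s (σ t s) (u (σ t s)) - u s‖
        ≤ ‖U s (σ t s) (u (σ t s))‖ + ‖u s‖ := norm_sub_le _ _
      _ ≤ M * ‖u (σ t s)‖ + ‖u s‖ := by
          gcongr
          exact (hGb u t s).trans (by gcongr)
      _ ≤ M * (ε / (2 * (M + 1))) + ε / (2 * (M + 1)) := by
          gcongr
          · exact (hab _ hout.2).le
          · exact (hab _ hout.1).le
      _ = ε / 2 := by field_simp
end

section
/- Let X be a Banach space, μ : ℝ → ℝ a continuous, strictly increasing function with μ(s) → −∞ as s → −∞ and μ(s) → +∞ as s → +∞ (a homeomorphism of ℝ with inverse μ⁻¹), and U an evolution family on X satisfying ‖U(s,τ)‖ ≤ K e^{α(μ(s)−μ(τ))} for all s ≥ τ (α > 0, K ≥ 1). Define V(t,s) = U(μ⁻¹(t), μ⁻¹(s)) for t ≥ s, (S_t v)(s) = V(s, s−t) v(s−t), and (T_t u)(s) = U(s, μ⁻¹(μ(s)−t)) u(μ⁻¹(μ(s)−t)). Then: (1) V is an evolution family on X with ‖V(t,s)‖ ≤ K e^{α(t−s)} for t ≥ s; (2) the map F : C₀(ℝ,X)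 → C₀(ℝ,X), F u = u ∘ μ⁻¹, is a well-defined invertible bounded linear operator with inverse F⁻¹ v = v ∘ μ; (3) T_t = F⁻¹ ∘ S_t ∘ F for every t ≥ 0, i.e., the semigroups {T_t} and {S_t} are similar. -/
open Set Filter Topology
open scoped ZeroAtInfty

namespace ZeroAtInftyContinuousMap

variable {Y Z X : Type*} [TopologicalSpace Y] [TopologicalSpace Z]
  [NormedAddCommGroup X]

theorem norm_apply_le_s13 (v : C₀(Y, X)) (s : Y) : ‖v s‖ ≤ ‖v‖ :=
  v.toBCF.norm_coe_le_norm s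

theorem norm_le_of_forall_le {v : C₀(Y, X)} {C : ℝ} (hC : 0 ≤ C) (h : ∀ s, ‖v s‖ ≤ C) :
    ‖v‖ ≤ C :=
  (BoundedContinuousFunction.norm_le (f := v.toBCF) hC).2 h

variable [NormedSpace ℝ X]

/-- Composition with a homeomorphism, as a continuous linear equivalence of spaces of functions
vanishing at infinity. -/
noncomputable def compHomeomorphCLE (h : Y ≃ₜ Z) : C₀(Z, X) ≃L[ℝ] C₀(Y, X) :=
  LinearEquiv.toContinuousLinearEquivOfBounds
    { toFun := fun v => ⟨⟨fun s => v (h s), v.continuous.comp h.continuous⟩,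
        (zero_at_infty v).comp h.isClosedEmbedding.tendsto_cocompact⟩
      invFun := fun v => ⟨⟨fun s => v (h.symm s), v.continuous.comp h.symm.continuous⟩,
        (zero_at_infty v).comp h.symm.isClosedEmbedding.tendsto_cocompact⟩
      map_add' := fun _ _ => rfl
      map_smul' := fun _ _ => rfl
      left_inv := fun v => by ext s; exact congrArg v (h.apply_symm_apply s)
      right_inv := fun v => by ext s; exact congrArg v (h.symm_apply_apply s) }
    1 1
    (fun v => by
      rw [one_mul]
      exact norm_le_of_forall_le (norm_nonneg v) fun s => norm_apply_le_s13 v (h s))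
    (fun v => by
      rw [one_mul]
      exact norm_le_of_forall_le (norm_nonneg v) fun s => norm_apply_le_s13 v (h.symm s))

/-- A strongly continuous, uniformly bounded family of operators acts continuously on
continuous functions. -/
theorem continuous_clm_apply_of_bounded {A : Y → X →L[ℝ] X} {C : ℝ} (hC : ∀ s, ‖A s‖ ≤ C)
    (hA : ∀ x, Continuous fun s => A s x) {v : Y → X} (hv : Continuous v) :
    Continuous fun s => A s (v s) := by
  refine continuous_iff_continuousAt.2 fun s₀ => ?_
  have h₁ : Tendsto (fun s => A s (v s - v s₀)) (𝓝 s₀) (𝓝 0) := by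
    refine squeeze_zero_norm (a := fun s => C * ‖v s - v s₀‖)
      (fun s => (A s).le_of_opNorm_le (hC s) _) ?_
    have : Continuous fun s => C * ‖v s - v s₀‖ := by fun_prop
    simpa using this.tendsto s₀
  simpa [ContinuousAt] using h₁.add ((hA (v s₀)).tendsto s₀)

/-- The multiplication operator induced by a strongly continuous, uniformly bounded family of
operators on functions vanishing at infinity. -/
noncomputable def mulCLM (A : Y → X →L[ℝ] X) (C : ℝ) (hC : ∀ s, ‖A s‖ ≤ C)
    (hA : ∀ x, Continuous fun s => A s x) : C₀(Y, X) →L[ℝ] C₀(Y, X) :=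
  LinearMap.mkContinuousOfExistsBound
    { toFun := fun v => ⟨⟨fun s => A s (v s), continuous_clm_apply_of_bounded hC hA v.continuous⟩,
        squeeze_zero_norm (fun s => (A s).le_of_opNorm_le (hC s) _)
          (by simpa using (zero_at_infty v).norm.const_mul C)⟩
      map_add' := fun u v => by ext s; exact map_add (A s) (u s) (v s)
      map_smul' := fun c v => by ext s; exact map_smul (A s) c (v s) }
    ⟨max C 0, fun v => norm_le_of_forall_le (by positivity) fun s =>
      ((A s).le_of_opNorm_le ((hC s).trans (le_max_left C 0)) _).trans
        (by gcongr; exact norm_apply_le_s13 v s)⟩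

end ZeroAtInftyContinuousMap

/-- With `μ` a strictly increasing homeomorphism of `ℝ` (inverse `μinv`)
and `U` an evolution family with `‖U s τ‖ ≤ K e^{α(μ s − μ τ)}` for `s ≥ τ`, define
`V t s = U (μinv t) (μinv s)`, `(S_t v)(s) = V(s, s−t) v(s−t)` and
`(T_t u)(s) = U(s, μinv(μ s − t)) u(μinv(μ s − t))`. Then: (1) `V` is an evolution
family with `‖V t s‖ ≤ K e^{α(t−s)}`; (2) `F u = u ∘ μinv` is an invertible bounded
linear operator on `C₀(ℝ, X)` with inverse `F⁻¹ v = v ∘ μ`; (3) `T_t = F⁻¹ ∘ S_t ∘ F`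
for every `t ≥ 0`, i.e. the semigroups `{T_t}` and `{S_t}` are similar. -/
theorem generalized_evolution_semigroup_similar_to_classical
    (X : Type*) [NormedAddCommGroup X] [NormedSpace ℝ X] [CompleteSpace X]
    (μ μinv : ℝ → ℝ)
    (hμc : Continuous μ) (hμm : StrictMono μ)
    (hμbot : Tendsto μ atBot atBot) (hμtop : Tendsto μ atTop atTop)
    (hinv₁ : ∀ s : ℝ, μinv (μ s) = s) (hinv₂ : ∀ s : ℝ, μ (μinv s) = s)
    (U : ℝ → ℝ → (X →L[ℝ] X))
    (hU1 : ∀ t : ℝ, U t t = ContinuousLinearMap.id ℝ X)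
    (hU2 : ∀ t τ s : ℝ, s ≤ τ → τ ≤ t → (U t τ).comp (U τ s) = U t s)
    (hU3 : ∀ x : X, ContinuousOn (fun p : ℝ × ℝ => U p.1 p.2 x) {p : ℝ × ℝ | p.2 ≤ p.1})
    (K α : ℝ) (hα : 0 < α) (hK : 1 ≤ K)
    (hbound : ∀ s τ : ℝ, τ ≤ s → ‖U s τ‖ ≤ K * Real.exp (α * (μ s - μ τ)))
    (V : ℝ → ℝ → (X →L[ℝ] X))
    (hV : ∀ t s : ℝ, V t s = U (μinv t) (μinv s)) :
    -- (1) `V` is an exponentially bounded evolution family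
    ((∀ t : ℝ, V t t = ContinuousLinearMap.id ℝ X) ∧
      (∀ t τ s : ℝ, s ≤ τ → τ ≤ t → (V t τ).comp (V τ s) = V t s) ∧
      (∀ x : X, ContinuousOn (fun p : ℝ × ℝ => V p.1 p.2 x) {p : ℝ × ℝ | p.2 ≤ p.1}) ∧
      (∀ t s : ℝ, s ≤ t → ‖V t s‖ ≤ K * Real.exp (α * (t - s)))) ∧
    -- (2) and (3)
    ∃ F : C₀(ℝ, X) ≃L[ℝ] C₀(ℝ, X),
      (∀ u : C₀(ℝ, X), ∀ s : ℝ, F u s = u (μinv s)) ∧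
      (∀ v : C₀(ℝ, X), ∀ s : ℝ, F.symm v s = v (μ s)) ∧
      ∃ T S : ℝ → (C₀(ℝ, X) →L[ℝ] C₀(ℝ, X)),
        (∀ t : ℝ, 0 ≤ t → ∀ u : C₀(ℝ, X), ∀ s : ℝ,
          T t u s = U s (μinv (μ s - t)) (u (μinv (μ s - t)))) ∧
        (∀ t : ℝ, 0 ≤ t → ∀ v : C₀(ℝ, X), ∀ s : ℝ,
          S t v s = V s (s - t) (v (s - t))) ∧
        (∀ t : ℝ, 0 ≤ t →
          T t = (F.symm : C₀(ℝ, X) →L[ℝ] C₀(ℝ, X)).comp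
            ((S t).comp (F : C₀(ℝ, X) →L[ℝ] C₀(ℝ, X)))) := by
  let e : ℝ ≃ₜ ℝ := (hμm.orderIsoOfRightInverse μ μinv hinv₂).toHomeomorph
  have hmono : Monotone μinv :=
    (hμm.orderIsoOfRightInverse μ μinv hinv₂).symm.monotone
  have hcont : Continuous μinv := e.symm.continuous
  have hVb : ∀ t s : ℝ, s ≤ t → ‖V t s‖ ≤ K * Real.exp (α * (t - s)) := fun t s hst => by
    simpa only [hV, hinv₂] using hbound _ _ (hmono hst)
  have hVc : ∀ x : X,
      ContinuousOn (fun p : ℝ × ℝ => V p.1 p.2 x) {p : ℝ × ℝ | p.2 ≤ p.1} := fun x => by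
    simp only [hV]
    exact (hU3 x).comp (f := fun p : ℝ × ℝ => (μinv p.1, μinv p.2)) (by fun_prop)
      fun p hp => hmono hp
  refine ⟨⟨fun t => by rw [hV, hU1], fun t τ s h₁ h₂ => ?_, hVc, hVb⟩, ?_⟩
  · simpa only [hV] using hU2 _ _ _ (hmono h₁) (hmono h₂)
  have hS : ∀ t : ℝ, ∃ S : C₀(ℝ, X) →L[ℝ] C₀(ℝ, X),
      0 ≤ t → ∀ v : C₀(ℝ, X), ∀ s : ℝ, S v s = V s (s - t) (v (s - t)) := fun t => by
    by_cases ht : 0 ≤ t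
    · refine ⟨(ZeroAtInftyContinuousMap.mulCLM (fun s => V s (s - t)) (K * Real.exp (α * t))
        (fun s => by simpa using hVb s (s - t) (by linarith))
        (fun x => (hVc x).comp_continuous (f := fun s : ℝ => (s, s - t)) (by fun_prop)
          fun s => by simpa using ht)).comp
        (ZeroAtInftyContinuousMap.compHomeomorphCLE
          (Homeomorph.subRight t)).toContinuousLinearMap, fun _ v s => rfl⟩
    · exact ⟨0, fun h => absurd h ht⟩
  choose S hS using hS
  let F : C₀(ℝ, X) ≃L[ℝ] C₀(ℝ, X) := ZeroAtInftyContinuousMap.compHomeomorphCLE e.symm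
  refine ⟨F, fun _ _ => rfl, fun _ _ => rfl,
    fun t => (F.symm : C₀(ℝ, X) →L[ℝ] C₀(ℝ, X)).comp
      ((S t).comp (F : C₀(ℝ, X) →L[ℝ] C₀(ℝ, X))), S, fun t ht u s => ?_, hS, fun _ _ => rfl⟩
  change S t (F u) (μ s) = _
  rw [hS t ht, hV, hinv₁]
  rfl
end

section
/- Let X be a complex Banach space, μ : ℝ → ℝ a continuous, strictly increasing function with μ(s) → −∞ as s → −∞ and μ(s) → +∞ as s → +∞ (a homeomorphism of ℝ with inverse μ⁻¹), and U an evolution family on X satisfying ‖U(s,τ)‖ ≤ K e^{α(μ(s)−μ(τ))} for all s ≥ τ (α > 0, K ≥ 1). Let T_t be the generalized evolution semigroup on C₀(ℝ,X). Then for each t > 0 the spectrum σ(T_t) ⊆ ℂ of the bounded operator T_t is rotationally invariant: for every λ ∈ ℂ with |λ| = 1 one has λ·σ(T_t) = σ(T_t). -/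
open Set Filter Topology
open scoped ZeroAtInfty

section CircleMul

variable {Y X : Type*} [TopologicalSpace Y] [NormedAddCommGroup X] [NormedSpace ℂ X]

/-- Multiplication by a continuous circle-valued function, as a continuous linear map
on `C₀(Y, X)`. -/
noncomputable def circleMulCLM (c : C(Y, Circle)) : C₀(Y, X) →L[ℂ] C₀(Y, X) :=
  LinearMap.mkContinuous
    { toFun := fun u =>
        { toFun := fun s => (c s : ℂ) • u s
          continuous_toFun :=
            (continuous_subtype_val.comp c.continuous).smul u.continuous
          zero_at_infty' := by
            have h := (zero_at_infty u).norm
            rw [norm_zero] at h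
            refine squeeze_zero_norm (fun s => ?_) h
            rw [norm_smul, Circle.norm_coe, one_mul] }
      map_add' := fun u v => by ext s; simp
      map_smul' := fun a u => by
        ext s
        exact smul_comm (c s : ℂ) a (u s) }
    1 (fun u => by
      rw [one_mul, ← ZeroAtInftyContinuousMap.norm_toBCF_eq_norm,
        BoundedContinuousFunction.norm_le (norm_nonneg _)]
      intro s
      rw [← ZeroAtInftyContinuousMap.norm_toBCF_eq_norm]
      refine le_trans (le_of_eq ?_) (u.toBCF.norm_coe_le_norm s)
      exact (norm_smul _ _).trans (by rw [Circle.norm_coe, one_mul]; rfl))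

@[simp]
theorem circleMulCLM_apply (c : C(Y, Circle)) (u : C₀(Y, X)) (s : Y) :
    circleMulCLM c u s = (c s : ℂ) • u s :=
  rfl

/-- Multiplication by a continuous circle-valued function is invertible on `C₀(Y, X)`. -/
noncomputable def circleMulUnit (c : C(Y, Circle)) : (C₀(Y, X) →L[ℂ] C₀(Y, X))ˣ where
  val := circleMulCLM c
  inv := circleMulCLM c⁻¹
  val_inv := by ext u s; simp [smul_smul]
  inv_val := by ext u s; simp [smul_smul]

end CircleMul

/-- An element conjugate to a unit scalar multiple of itself has a spectrum invariant
under that scalar. -/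
theorem spectrum.image_mul_eq_of_mul_eq_smul_mul {A : Type*} [Ring A] [Algebra ℂ A]
    {a : A} (m : Aˣ) {c : ℂ} (hc : c ≠ 0) (h : (m : A) * a = c • (a * m)) :
    (fun z : ℂ => c * z) '' spectrum ℂ a = spectrum ℂ a := by
  have h₁ : (m : A) * a * ((m⁻¹ : Aˣ) : A) = Units.mk0 c hc • a := by
    rw [h, smul_mul_assoc, mul_assoc, Units.mul_inv, mul_one]
    rfl
  have h₂ := spectrum.units_conjugate (R := ℂ) (a := a) (u := m)
  rw [h₁, spectrum.unit_smul_eq_smul] at h₂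
  exact h₂

/-- Let `X` be a complex Banach space, `μ` a strictly increasing
homeomorphism of `ℝ` (inverse `μinv`), `U` an evolution family with
`‖U s τ‖ ≤ K e^{α(μ s − μ τ)}` for `s ≥ τ`, and `{T_t}` the generalized evolution
semigroup on `C₀(ℝ, X)`. Then for each `t > 0` the spectrum `σ(T_t) ⊆ ℂ` is
rotationally invariant: `λ·σ(T_t) = σ(T_t)` for every `λ ∈ ℂ` with `|λ| = 1`. -/
theorem generalized_evolution_semigroup_spectrum_rotation_invariant
    (X : Type*) [NormedAddCommGroup X] [NormedSpace ℂ X] [CompleteSpace X]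
    (μ μinv : ℝ → ℝ)
    (hμc : Continuous μ) (hμm : StrictMono μ)
    (hμbot : Tendsto μ atBot atBot) (hμtop : Tendsto μ atTop atTop)
    (hinv₁ : ∀ s : ℝ, μinv (μ s) = s) (hinv₂ : ∀ s : ℝ, μ (μinv s) = s)
    (U : ℝ → ℝ → (X →L[ℂ] X))
    (hU1 : ∀ t : ℝ, U t t = ContinuousLinearMap.id ℂ X)
    (hU2 : ∀ t τ s : ℝ, s ≤ τ → τ ≤ t → (U t τ).comp (U τ s) = U t s)
    (hU3 : ∀ x : X, ContinuousOn (fun p : ℝ × ℝ => U p.1 p.2 x) {p : ℝ × ℝ | p.2 ≤ p.1})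
    (K α : ℝ) (hα : 0 < α) (hK : 1 ≤ K)
    (hbound : ∀ s τ : ℝ, τ ≤ s → ‖U s τ‖ ≤ K * Real.exp (α * (μ s - μ τ)))
    (T : ℝ → (C₀(ℝ, X) →L[ℂ] C₀(ℝ, X)))
    (hT : ∀ t : ℝ, 0 ≤ t → ∀ u : C₀(ℝ, X), ∀ s : ℝ,
      T t u s = U s (μinv (μ s - t)) (u (μinv (μ s - t)))) :
    ∀ t : ℝ, 0 < t → ∀ lam : ℂ, ‖lam‖ = 1 →
      (fun z : ℂ => lam * z) '' spectrum ℂ (T t) = spectrum ℂ (T t) := by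
  intro t ht lam hlam
  let c : C(ℝ, Circle) :=
    ⟨fun s => Circle.exp (lam.arg / t * μ s), by fun_prop⟩
  refine spectrum.image_mul_eq_of_mul_eq_smul_mul (circleMulUnit c)
    (norm_ne_zero_iff.mp (by rw [hlam]; exact one_ne_zero)) ?_
  have hlam' : lam = Complex.exp (lam.arg * Complex.I) := by
    simpa [hlam] using (Complex.norm_mul_exp_arg_mul_I lam).symm
  have hc : ∀ s, (c s : ℂ) = lam * c (μinv (μ s - t)) := fun s => by
    have ht' : (t : ℂ) ≠ 0 := mod_cast ht.ne'
    conv_rhs => rw [hlam']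
    simp only [c, ContinuousMap.coe_mk, Circle.coe_exp, hinv₂, ← Complex.exp_add]
    congr 1
    push_cast
    field_simp
    ring
  ext u s
  change (c s : ℂ) • T t u s = lam • T t (circleMulCLM c u) s
  rw [hT t ht.le, hT t ht.le, circleMulCLM_apply, map_smul, smul_smul, ← hc]
end

section
/- Let X be a Banach space, μ : ℝ → ℝ a continuously differentiable, strictly increasing function with μ(s) → −∞ as s → −∞ and μ(s) → +∞ as s → +∞ (a homeomorphism of ℝ with inverse μ⁻¹), and U an evolution family on X satisfying ‖U(s,τ)‖ ≤ K e^{α(μ(s)−μ(τ))} for all s ≥ τ (α > 0, K ≥ 1). Let T_t be the generalized evolution semigroup on C₀(ℝ,X), and let u, f ∈ C₀(ℝ,X). Then (T_h u − u)/h converges in the supremum norm to −f as h → 0⁺ (i.e., u belongs to the domain of the generator G of {T_t} and Gu = −f) if and only if u(t) = U(t,s)u(s) + ∫_s^t μ′(ξ) U(t,ξ) f(ξ) dξ for all t ≥ s. -/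
open Set Filter Topology MeasureTheory
open scoped ZeroAtInfty

/-- Evolution families on `X` that are exponentially bounded along `μ`. -/
structure IsExpBoundedEvolutionFamily {X : Type*} [NormedAddCommGroup X] [NormedSpace ℝ X]
    (μ : ℝ → ℝ) (U : ℝ → ℝ → (X →L[ℝ] X)) (K α : ℝ) : Prop where
  refl : ∀ t : ℝ, U t t = ContinuousLinearMap.id ℝ X
  comp : ∀ t τ s : ℝ, s ≤ τ → τ ≤ t → (U t τ).comp (U τ s) = U t s
  continuousOn : ∀ x : X,
    ContinuousOn (fun p : ℝ × ℝ => U p.1 p.2 x) {p : ℝ × ℝ | p.2 ≤ p.1}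
  rate_nonneg : 0 ≤ α
  const_pos : 0 < K
  bound : ∀ s τ : ℝ, τ ≤ s → ‖U s τ‖ ≤ K * Real.exp (α * (μ s - μ τ))

/-- `T` is the evolution semigroup of `U` on `C₀(ℝ, X)`, reparametrized by the strictly increasing
homeomorphism `μ` with inverse `μinv`. -/
structure IsEvolutionSemigroup {X : Type*} [NormedAddCommGroup X] [NormedSpace ℝ X]
    (μ μinv : ℝ → ℝ) (U : ℝ → ℝ → (X →L[ℝ] X)) (T : ℝ → (C₀(ℝ, X) →L[ℝ] C₀(ℝ, X))) : Prop where
  strictMono : StrictMono μ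
  continuous : Continuous μ
  inv_apply : ∀ s : ℝ, μinv (μ s) = s
  apply_inv : ∀ s : ℝ, μ (μinv s) = s
  apply : ∀ t : ℝ, 0 ≤ t → ∀ w : C₀(ℝ, X), ∀ s : ℝ,
    T t w s = U s (μinv (μ s - t)) (w (μinv (μ s - t)))

theorem ZeroAtInftyContinuousMap.norm_le_iff_forall {α β : Type*} [TopologicalSpace α]
    [NormedAddCommGroup β] {f : C₀(α, β)} {C : ℝ} (hC : 0 ≤ C) :
    ‖f‖ ≤ C ↔ ∀ x, ‖f x‖ ≤ C :=
  BoundedContinuousFunction.norm_le (f := f.toBCF) hC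

section

variable {X : Type*} [NormedAddCommGroup X] [NormedSpace ℝ X] {μ μinv : ℝ → ℝ}
  {U : ℝ → ℝ → (X →L[ℝ] X)} {K α : ℝ} {T : ℝ → (C₀(ℝ, X) →L[ℝ] C₀(ℝ, X))}

theorem IsExpBoundedEvolutionFamily.continuous_apply {Y : Type*} [TopologicalSpace Y]
    (hU : IsExpBoundedEvolutionFamily μ U K α) (hμ : Continuous μ) {a b : Y → ℝ} {x : Y → X}
    (ha : Continuous a) (hb : Continuous b) (hx : Continuous x) (hab : ∀ y, b y ≤ a y) :
    Continuous fun y => U (a y) (b y) (x y) := by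
  refine continuous_iff_continuousAt.2 fun y₀ => ?_
  have h1 : Continuous fun y => U (a y) (b y) (x y₀) :=
    (hU.continuousOn (x y₀)).comp_continuous (ha.prodMk hb) hab
  have h2 : Tendsto (fun y => U (a y) (b y) (x y - x y₀)) (𝓝 y₀) (𝓝 0) := by
    have h3 : Continuous fun y =>
        K * Real.exp (α * (μ (a y) - μ (b y))) * ‖x y - x y₀‖ := by fun_prop
    refine squeeze_zero_norm (fun y => ?_) (by simpa using h3.tendsto y₀)
    exact (U (a y) (b y)).le_of_opNorm_le (hU.bound _ _ (hab y)) _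
  simpa [ContinuousAt] using h1.continuousAt.tendsto.add h2

namespace IsEvolutionSemigroup

theorem monotone_inv (hT : IsEvolutionSemigroup μ μinv U T) : Monotone μinv := fun a b hab =>
  hT.strictMono.le_iff_le.1 (by simpa only [hT.apply_inv] using hab)

theorem continuous_inv (hT : IsEvolutionSemigroup μ μinv U T) : Continuous μinv :=
  hT.monotone_inv.continuous_of_surjective fun s => ⟨μ s, hT.inv_apply s⟩

theorem inv_sub_le (hT : IsEvolutionSemigroup μ μinv U T) (s : ℝ) {r : ℝ} (hr : 0 ≤ r) :
    μinv (μ s - r) ≤ s := by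
  simpa only [hT.inv_apply] using hT.monotone_inv (sub_le_self (μ s) hr)

theorem zero_apply (hT : IsEvolutionSemigroup μ μinv U T)
    (hU : IsExpBoundedEvolutionFamily μ U K α) (w : C₀(ℝ, X)) : T 0 w = w := by
  ext s
  simp [hT.apply 0 le_rfl, hT.inv_apply, hU.refl]

theorem add_apply (hT : IsEvolutionSemigroup μ μinv U T)
    (hU : IsExpBoundedEvolutionFamily μ U K α) {r h : ℝ} (hr : 0 ≤ r) (hh : 0 ≤ h)
    (w : C₀(ℝ, X)) : T (r + h) w = T r (T h w) := by
  ext s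
  have hle : μinv (μ s - r - h) ≤ μinv (μ s - r) := hT.monotone_inv (by linarith)
  rw [hT.apply _ (add_nonneg hr hh), hT.apply _ hr, hT.apply _ hh, hT.apply_inv,
    ← ContinuousLinearMap.comp_apply, hU.comp _ _ _ hle (hT.inv_sub_le s hr), sub_sub]

theorem continuous_max_apply (hT : IsEvolutionSemigroup μ μinv U T)
    (hU : IsExpBoundedEvolutionFamily μ U K α) (w : C₀(ℝ, X)) :
    Continuous fun p : ℝ × ℝ => T (max p.1 0) w p.2 := by
  have hμ := hT.continuous
  have hinv := hT.continuous_inv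
  have hw : Continuous w := map_continuous w
  simp only [hT.apply _ (le_max_right _ 0)]
  exact hU.continuous_apply hμ (by fun_prop) (by fun_prop) (by fun_prop)
    fun p => hT.inv_sub_le _ (le_max_right _ _)

theorem norm_apply_le (hT : IsEvolutionSemigroup μ μinv U T)
    (hU : IsExpBoundedEvolutionFamily μ U K α) {r : ℝ} (hr : 0 ≤ r) (hr1 : r ≤ 1)
    (w : C₀(ℝ, X)) (s : ℝ) :
    ‖T r w s‖ ≤ K * Real.exp α * ‖w (μinv (μ s - r))‖ := by
  rw [hT.apply r hr]
  refine (U _ _).le_of_opNorm_le ((hU.bound _ _ (hT.inv_sub_le s hr)).trans ?_) _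
  rw [hT.apply_inv, sub_sub_cancel]
  have := hU.const_pos
  have : α * r ≤ α := mul_le_of_le_one_right hU.rate_nonneg hr1
  gcongr

theorem tendsto_apply (hT : IsEvolutionSemigroup μ μinv U T)
    (hU : IsExpBoundedEvolutionFamily μ U K α) (w : C₀(ℝ, X)) :
    Tendsto (fun r => T r w) (𝓝[≥] 0) (𝓝 w) := by
  rw [Metric.tendsto_nhds]
  intro ε hε
  have hC : 0 < K * Real.exp α := mul_pos hU.const_pos (Real.exp_pos α)
  obtain ⟨A, B, hA, hB⟩ : ∃ A B, (∀ s ≤ A, K * Real.exp α * ‖w s‖ < ε / 4 ∧ ‖w s‖ < ε / 4) ∧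
      ∀ s ≥ B, K * Real.exp α * ‖w s‖ < ε / 4 ∧ ‖w s‖ < ε / 4 := by
    have h0 : Tendsto (fun s => ‖w s‖) (cocompact ℝ) (𝓝 0) := by
      simpa using (zero_at_infty w).norm
    have h1 : ∀ᶠ s in cocompact ℝ, K * Real.exp α * ‖w s‖ < ε / 4 ∧ ‖w s‖ < ε / 4 :=
      ((h0.const_mul (K * Real.exp α)).eventually_lt_const (by simpa using by positivity)).and
        (h0.eventually_lt_const (by positivity))
    rw [cocompact_eq_atBot_atTop, eventually_sup, eventually_atBot, eventually_atTop] at h1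
    exact ⟨_, _, h1.1.choose_spec, h1.2.choose_spec⟩
  have hloc : ∀ᶠ r in 𝓝 (0 : ℝ), ∀ s ∈ Icc A (μinv (μ B + 1)),
      ‖T (max r 0) w s - w s‖ < ε / 2 := by
    refine isCompact_Icc.eventually_forall_of_forall_eventually fun s _ => ?_
    have hc : Continuous fun p : ℝ × ℝ => ‖T (max p.1 0) w p.2 - w p.2‖ :=
      ((hT.continuous_max_apply hU w).sub ((map_continuous w).comp continuous_snd)).norm
    refine (hc.tendsto (0, s)).eventually_lt_const ?_
    simpa [hT.zero_apply hU] using hε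
  filter_upwards [self_mem_nhdsWithin, nhdsWithin_le_nhds hloc,
    nhdsWithin_le_nhds (eventually_le_nhds (zero_lt_one (α := ℝ)))] with r hr hloc hr1
  rw [mem_Ici] at hr
  rw [dist_eq_norm]
  refine lt_of_le_of_lt
    ((ZeroAtInftyContinuousMap.norm_le_iff_forall (by positivity)).2 fun s => ?_)
    (half_lt_self hε)
  have htri : ‖T r w s - w s‖ ≤ K * Real.exp α * ‖w (μinv (μ s - r))‖ + ‖w s‖ :=
    (norm_sub_le _ _).trans (by gcongr; exact hT.norm_apply_le hU hr hr1 w s)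
  change ‖T r w s - w s‖ ≤ ε / 2
  rcases le_total s A with hsA | hsA
  · linarith [(hA s hsA).2, (hA _ ((hT.inv_sub_le s hr).trans hsA)).1]
  rcases le_total s (μinv (μ B + 1)) with hsB | hsB
  · simpa [max_eq_left hr] using (hloc s ⟨hsA, hsB⟩).le
  · have hs : μ B + 1 ≤ μ s := by
      simpa only [hT.apply_inv] using hT.strictMono.monotone hsB
    have h1 : B ≤ μinv (μ s - r) := by
      simpa only [hT.inv_apply] using
        hT.monotone_inv (show μ B ≤ μ s - r by linarith)
    linarith [(hB _ h1).1, (hB s (h1.trans (hT.inv_sub_le s hr))).2]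

theorem intervalIntegrable_apply (hT : IsEvolutionSemigroup μ μinv U T)
    (hU : IsExpBoundedEvolutionFamily μ U K α) (w : C₀(ℝ, X)) (s : ℝ) {h : ℝ} (hh : 0 ≤ h) :
    IntervalIntegrable (fun r => T r w s) volume 0 h := by
  have hc : Continuous fun r => T (max r 0) w s :=
    (hT.continuous_max_apply hU w).comp (.prodMk_left s)
  refine (hc.intervalIntegrable 0 h).congr fun r hr => ?_
  rw [uIoc_of_le hh] at hr
  simp only [max_eq_left hr.1.le]

theorem integral_deriv_smul (hT : IsEvolutionSemigroup μ μinv U T)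
    (hU : IsExpBoundedEvolutionFamily μ U K α) (hμ : ContDiff ℝ 1 μ) (w : C₀(ℝ, X)) {s t : ℝ}
    (hst : s ≤ t) :
    ∫ ξ in s..t, deriv μ ξ • U t ξ (w ξ) = ∫ r in (0 : ℝ)..(μ t - μ s), T r w t := by
  have hc : Continuous fun r => T (max r 0) w t :=
    (hT.continuous_max_apply hU w).comp (.prodMk_left t)
  have hsub := intervalIntegral.integral_deriv_smul_comp (a := s) (b := t)
    (f := fun ξ => μ t - μ ξ) (f' := fun ξ => -deriv μ ξ) (g := fun r => T (max r 0) w t)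
    (fun ξ _ => ((hμ.differentiable one_ne_zero).differentiableAt.hasDerivAt).const_sub _)
    (hμ.continuous_deriv le_rfl).neg.continuousOn hc
  rw [sub_self, intervalIntegral.integral_symm 0] at hsub
  simp only [neg_smul, intervalIntegral.integral_neg, neg_inj] at hsub
  have h0 : 0 ≤ μ t - μ s := sub_nonneg.2 (hT.strictMono.monotone hst)
  calc
    _ = ∫ ξ in s..t, deriv μ ξ • ((fun r => T (max r 0) w t) ∘ fun ξ => μ t - μ ξ) ξ := by
      refine intervalIntegral.integral_congr fun ξ hξ => ?_
      rw [uIcc_of_le hst] at hξ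
      have hξ0 : 0 ≤ μ t - μ ξ := sub_nonneg.2 (hT.strictMono.monotone hξ.2)
      simp only [Function.comp_apply, max_eq_left hξ0, hT.apply _ hξ0, sub_sub_cancel,
        hT.inv_apply]
    _ = _ := hsub
    _ = _ := by
      refine intervalIntegral.integral_congr fun r hr => ?_
      rw [uIcc_of_le h0] at hr
      simp only [max_eq_left hr.1]

/-- The integral equation for `u` and `f` in terms of the semigroup. -/
theorem integral_equation_iff (hT : IsEvolutionSemigroup μ μinv U T)
    (hU : IsExpBoundedEvolutionFamily μ U K α) (hμ : ContDiff ℝ 1 μ) (u f : C₀(ℝ, X)) :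
    (∀ s t : ℝ, s ≤ t → u t = U t s (u s) + ∫ ξ in s..t, deriv μ ξ • U t ξ (f ξ)) ↔
      ∀ h : ℝ, 0 ≤ h → ∀ t : ℝ, u t = T h u t + ∫ r in (0 : ℝ)..h, T r f t := by
  refine ⟨fun H h hh t => ?_, fun H s t hst => ?_⟩
  · have hle := hT.inv_sub_le t hh
    rw [hT.apply h hh]
    simpa only [hT.integral_deriv_smul hU hμ f hle, hT.apply_inv, sub_sub_cancel] using H _ t hle
  · have h0 : 0 ≤ μ t - μ s := sub_nonneg.2 (hT.strictMono.monotone hst)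
    simpa only [hT.integral_deriv_smul hU hμ f hst, hT.apply _ h0, sub_sub_cancel,
      hT.inv_apply] using H _ h0 t

variable [CompleteSpace X]

theorem eq_add_integral_of_tendsto (hT : IsEvolutionSemigroup μ μinv U T)
    (hU : IsExpBoundedEvolutionFamily μ U K α) {u f : C₀(ℝ, X)}
    (H : Tendsto (fun h : ℝ => h⁻¹ • (T h u - u)) (𝓝[>] (0 : ℝ)) (𝓝 (-f)))
    {h : ℝ} (hh : 0 ≤ h) (t : ℝ) : u t = T h u t + ∫ r in (0 : ℝ)..h, T r f t := by
  have hc : Continuous fun r => T (max r 0) u t :=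
    (hT.continuous_max_apply hU u).comp (.prodMk_left t)
  have hcont : ContinuousOn (fun r => T r u t) (Icc 0 h) :=
    hc.continuousOn.congr fun r hr => by simp only [max_eq_left hr.1]
  have hderiv : ∀ r ∈ Ioo 0 h, HasDerivWithinAt (fun r => T r u t) (-T r f t) (Ioi r) r := by
    intro r hr
    rw [hasDerivWithinAt_iff_tendsto_slope' self_notMem_Ioi]
    have hev : Continuous fun v : C₀(ℝ, X) => v t :=
      (BoundedContinuousFunction.lipschitz_eval_const t).continuous.comp
        (ZeroAtInftyContinuousMap.isometry_toBCF).continuous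
    have hshift : Tendsto (fun r' => r' - r) (𝓝[>] r) (𝓝[>] 0) := by
      refine tendsto_nhdsWithin_iff.2 ⟨?_, ?_⟩
      · have hcts : Continuous fun r' : ℝ => r' - r := by fun_prop
        exact (hcts.tendsto' _ _ (sub_self r)).mono_left nhdsWithin_le_nhds
      · filter_upwards [self_mem_nhdsWithin] with r' hr' using sub_pos.2 (mem_Ioi.1 hr')
    have hlim := ((hev.comp (T r).continuous).tendsto (-f)).comp (H.comp hshift)
    simp only [Function.comp_apply, map_neg, ZeroAtInftyContinuousMap.neg_apply] at hlim
    refine hlim.congr' ?_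
    filter_upwards [self_mem_nhdsWithin] with r' hr'
    have hadd := hT.add_apply hU hr.1.le (sub_nonneg.2 (mem_Ioi.1 hr').le) u
    rw [add_sub_cancel] at hadd
    simp [slope, hadd]
  have hint := (hT.intervalIntegrable_apply hU f t hh).neg
  have key := intervalIntegral.integral_eq_sub_of_hasDeriv_right_of_le hh hcont hderiv hint
  rw [intervalIntegral.integral_neg, hT.zero_apply hU] at key
  rw [neg_eq_iff_eq_neg.1 key]
  abel

theorem tendsto_of_eq_add_integral (hT : IsEvolutionSemigroup μ μinv U T)
    (hU : IsExpBoundedEvolutionFamily μ U K α) {u f : C₀(ℝ, X)}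
    (H : ∀ h : ℝ, 0 ≤ h → ∀ t : ℝ, u t = T h u t + ∫ r in (0 : ℝ)..h, T r f t) :
    Tendsto (fun h : ℝ => h⁻¹ • (T h u - u)) (𝓝[>] (0 : ℝ)) (𝓝 (-f)) := by
  rw [Metric.tendsto_nhds]
  intro ε hε
  obtain ⟨δ, hδ, hδε⟩ := mem_nhdsGE_iff_exists_Ico_subset.1
    (Metric.tendsto_nhds.1 (hT.tendsto_apply hU f) (ε / 2) (half_pos hε))
  filter_upwards [Ioo_mem_nhdsGT (mem_Ioi.1 hδ)] with h hh
  rw [dist_eq_norm, sub_neg_eq_add]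
  refine lt_of_le_of_lt
    ((ZeroAtInftyContinuousMap.norm_le_iff_forall (by positivity)).2 fun t => ?_)
    (half_lt_self hε)
  have hsub : ∫ r in (0 : ℝ)..h, (T r f t - f t) = (∫ r in (0 : ℝ)..h, T r f t) - h • f t := by
    rw [intervalIntegral.integral_sub (hT.intervalIntegrable_apply hU f t hh.1.le)
      intervalIntegrable_const, intervalIntegral.integral_const, sub_zero]
  have hbd : ‖∫ r in (0 : ℝ)..h, (T r f t - f t)‖ ≤ ε / 2 * |h - 0| := by
    refine intervalIntegral.norm_integral_le_of_norm_le_const fun r hr => ?_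
    rw [uIoc_of_le hh.1.le] at hr
    have hr' : dist (T r f) f < ε / 2 := hδε ⟨hr.1.le, hr.2.trans_lt hh.2⟩
    rw [dist_eq_norm] at hr'
    exact (ZeroAtInftyContinuousMap.norm_le_iff_forall (by positivity)).1 hr'.le t
  have heq : (h⁻¹ • (T h u - u) + f) t = -(h⁻¹ • ∫ r in (0 : ℝ)..h, (T r f t - f t)) := by
    have hu : T h u t - u t = -∫ r in (0 : ℝ)..h, T r f t := by
      rw [sub_eq_iff_eq_add, neg_add_eq_sub, eq_sub_iff_add_eq]
      exact (H h hh.1.le t).symm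
    change h⁻¹ • (T h u t - u t) + f t = _
    rw [hsub, hu, smul_sub, inv_smul_smul₀ hh.1.ne']
    module
  rw [heq, norm_neg, norm_smul, norm_inv, Real.norm_of_nonneg hh.1.le, inv_mul_le_iff₀ hh.1,
    mul_comm]
  simpa [abs_of_pos hh.1] using hbd

end IsEvolutionSemigroup

end

/-- Let `μ` be a continuously differentiable, strictly increasing
homeomorphism of `ℝ` (inverse `μinv`), `U` an evolution family with
`‖U s τ‖ ≤ K e^{α(μ s − μ τ)}` for `s ≥ τ`, `{T_t}` the generalized evolution semigroup
on `C₀(ℝ, X)`, and `u, f ∈ C₀(ℝ, X)`. Then `(T_h u − u)/h → −f` in sup-norm as `h → 0⁺`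
(i.e. `u ∈ D(G)` and `G u = −f`) if and only if
`u(t) = U(t,s) u(s) + ∫_s^t μ′(ξ) U(t,ξ) f(ξ) dξ` for all `t ≥ s`. -/
theorem generator_iff_integral_equation
    (X : Type*) [NormedAddCommGroup X] [NormedSpace ℝ X] [CompleteSpace X]
    (μ μinv : ℝ → ℝ)
    (hμc1 : ContDiff ℝ 1 μ) (hμm : StrictMono μ)
    (hμbot : Tendsto μ atBot atBot) (hμtop : Tendsto μ atTop atTop)
    (hinv₁ : ∀ s : ℝ, μinv (μ s) = s) (hinv₂ : ∀ s : ℝ, μ (μinv s) = s)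
    (U : ℝ → ℝ → (X →L[ℝ] X))
    (hU1 : ∀ t : ℝ, U t t = ContinuousLinearMap.id ℝ X)
    (hU2 : ∀ t τ s : ℝ, s ≤ τ → τ ≤ t → (U t τ).comp (U τ s) = U t s)
    (hU3 : ∀ x : X, ContinuousOn (fun p : ℝ × ℝ => U p.1 p.2 x) {p : ℝ × ℝ | p.2 ≤ p.1})
    (K α : ℝ) (hα : 0 < α) (hK : 1 ≤ K)
    (hbound : ∀ s τ : ℝ, τ ≤ s → ‖U s τ‖ ≤ K * Real.exp (α * (μ s - μ τ)))
    (T : ℝ → (C₀(ℝ, X) →L[ℝ] C₀(ℝ, X)))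
    (hT : ∀ t : ℝ, 0 ≤ t → ∀ w : C₀(ℝ, X), ∀ s : ℝ,
      T t w s = U s (μinv (μ s - t)) (w (μinv (μ s - t))))
    (u f : C₀(ℝ, X)) :
    Tendsto (fun h : ℝ => h⁻¹ • (T h u - u)) (𝓝[>] (0 : ℝ)) (𝓝 (-f)) ↔
      ∀ s t : ℝ, s ≤ t →
        u t = U t s (u s) + ∫ ξ in s..t, deriv μ ξ • U t ξ (f ξ) := by
  have hU : IsExpBoundedEvolutionFamily μ U K α :=
    ⟨hU1, hU2, hU3, hα.le, zero_lt_one.trans_le hK, hbound⟩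
  have hS : IsEvolutionSemigroup μ μinv U T := ⟨hμm, hμc1.continuous, hinv₁, hinv₂, hT⟩
  rw [hS.integral_equation_iff hU hμc1]
  exact ⟨fun H h hh t => hS.eq_add_integral_of_tendsto hU H hh t, hS.tendsto_of_eq_add_integral hU⟩
end

section
/- Let X be a Banach space, μ : ℝ → ℝ a continuous, strictly increasing function with μ(s) → −∞ as s → −∞ and μ(s) → +∞ as s → +∞ (a homeomorphism of ℝ with inverse μ⁻¹), and U an evolution family on X satisfying ‖U(s,τ)‖ ≤ K e^{α(μ(s)−μ(τ))} for all s ≥ τ (α > 0, K ≥ 1). Suppose the generalized evolution semigroup {T_t} on C₀(ℝ,X) is hyperbolic with structural projection 𝒫. Then 𝒫 commutes with multiplication by bounded continuous scalar functions: 𝒫(βu) = β·(𝒫u) for every bounded continuous function β : ℝ → ℝ and every u ∈ C₀(ℝ,X), where (βu)(s) = β(s)u(s). -/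
open Set Filter Topology
open scoped ZeroAtInfty

/-- The product of a bounded continuous scalar function and a function in `C₀`. -/
theorem ZeroAtInftyContinuousMap.exists_smul_of_bounded
    {Y X : Type*} [TopologicalSpace Y] [NormedAddCommGroup X] [NormedSpace ℝ X]
    {β : Y → ℝ} (hβ : Continuous β) {M : ℝ} (hM : ∀ s, |β s| ≤ M) (hM0 : 0 ≤ M) (u : C₀(Y, X)) :
    ∃ w : C₀(Y, X), (∀ s, w s = β s • u s) ∧ ‖w‖ ≤ M * ‖u‖ := by
  have hle : ∀ s, ‖β s • u s‖ ≤ M * ‖u s‖ := fun s => by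
    rw [norm_smul]
    exact mul_le_mul_of_nonneg_right (hM s) (norm_nonneg _)
  have hlim : Tendsto (fun s => β s • u s) (cocompact Y) (𝓝 0) := by
    refine squeeze_zero_norm hle ?_
    simpa using (u.zero_at_infty'.norm).const_mul M
  refine ⟨⟨⟨fun s => β s • u s, hβ.smul u.continuous⟩, hlim⟩, fun _ => rfl, ?_⟩
  rw [← ZeroAtInftyContinuousMap.norm_toBCF_eq_norm,
    BoundedContinuousFunction.norm_le (by positivity)]
  refine fun s => (hle s).trans (mul_le_mul_of_nonneg_left ?_ hM0)
  rw [← ZeroAtInftyContinuousMap.norm_toBCF_eq_norm]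
  exact u.toBCF.norm_coe_le_norm s

/-- A vector whose norm is at most `C e^{-νt}` for all `t ≥ 0` vanishes. -/
theorem eq_zero_of_norm_le_mul_exp_neg {E : Type*} [NormedAddCommGroup E] {x : E} {C ν : ℝ}
    (hν : 0 < ν) (h : ∀ t : ℝ, 0 ≤ t → ‖x‖ ≤ C * Real.exp (-ν * t)) : x = 0 := by
  have hlim : Tendsto (fun t : ℝ => C * Real.exp (-ν * t)) atTop (𝓝 0) := by
    have h1 : Tendsto (fun t : ℝ => -ν * t) atTop atBot :=
      tendsto_id.const_mul_atTop_of_neg (neg_lt_zero.mpr hν)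
    simpa using (Real.tendsto_exp_atBot.comp h1).const_mul C
  exact norm_le_zero_iff.mp
    (ge_of_tendsto hlim ((eventually_ge_atTop 0).mono fun t ht => h t ht))

/-- Suppose the generalized evolution semigroup `{T_t}` on `C₀(ℝ, X)`
(associated to `μ` and an evolution family `U` with `‖U s τ‖ ≤ K e^{α(μ s − μ τ)}`)
is hyperbolic with structural projection `PP`. Then `PP` commutes with multiplication
by bounded continuous scalar functions: `PP(βu) = β·(PPu)`. -/
theorem structural_projection_commutes_with_multiplication
    (X : Type*) [NormedAddCommGroup X] [NormedSpace ℝ X] [CompleteSpace X]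
    (μ μinv : ℝ → ℝ)
    (hμc : Continuous μ) (hμm : StrictMono μ)
    (hμbot : Tendsto μ atBot atBot) (hμtop : Tendsto μ atTop atTop)
    (hinv₁ : ∀ s : ℝ, μinv (μ s) = s) (hinv₂ : ∀ s : ℝ, μ (μinv s) = s)
    (U : ℝ → ℝ → (X →L[ℝ] X))
    (hU1 : ∀ t : ℝ, U t t = ContinuousLinearMap.id ℝ X)
    (hU2 : ∀ t τ s : ℝ, s ≤ τ → τ ≤ t → (U t τ).comp (U τ s) = U t s)
    (hU3 : ∀ x : X, ContinuousOn (fun p : ℝ × ℝ => U p.1 p.2 x) {p : ℝ × ℝ | p.2 ≤ p.1})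
    (K α : ℝ) (hα : 0 < α) (hK : 1 ≤ K)
    (hbound : ∀ s τ : ℝ, τ ≤ s → ‖U s τ‖ ≤ K * Real.exp (α * (μ s - μ τ)))
    -- the generalized evolution semigroup
    (T : ℝ → (C₀(ℝ, X) →L[ℝ] C₀(ℝ, X)))
    (hT : ∀ t : ℝ, 0 ≤ t → ∀ w : C₀(ℝ, X), ∀ s : ℝ,
      T t w s = U s (μinv (μ s - t)) (w (μinv (μ s - t))))
    -- hyperbolicity with structural projection `PP` (and `QQ = Id − PP`)
    (PP QQ : C₀(ℝ, X) →L[ℝ] C₀(ℝ, X))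
    (hQQ : QQ = ContinuousLinearMap.id ℝ (C₀(ℝ, X)) - PP)
    (hproj : PP.comp PP = PP)
    (hcomm : ∀ t : ℝ, 0 ≤ t → (T t).comp PP = PP.comp (T t))
    (hbij : ∀ t : ℝ, 0 ≤ t → Set.BijOn (T t) (Set.range QQ) (Set.range QQ))
    (ν N : ℝ) (hν : 0 < ν) (hN : 1 ≤ N)
    (hstable : ∀ t : ℝ, 0 ≤ t → ∀ u : C₀(ℝ, X),
      ‖T t (PP u)‖ ≤ N * Real.exp (-ν * t) * ‖u‖)
    (hunstable : ∀ t : ℝ, 0 ≤ t → ∀ u v : C₀(ℝ, X),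
      v ∈ Set.range QQ → T t v = QQ u → ‖v‖ ≤ N * Real.exp (-ν * t) * ‖u‖) :
    ∀ β : ℝ → ℝ, Continuous β → (∃ M : ℝ, ∀ s : ℝ, |β s| ≤ M) →
      ∀ u w : C₀(ℝ, X), (∀ s : ℝ, w s = β s • u s) →
        ∀ s : ℝ, PP w s = β s • PP u s := by
  rintro β hβ ⟨M, hM⟩ u w hw s
  have hM0 : 0 ≤ M := (abs_nonneg _).trans (hM 0)
  have hinvc : Continuous μinv :=
    Monotone.continuous_of_surjective
      (fun a b hab => hμm.le_iff_le.mp (by rwa [hinv₂, hinv₂])) fun x => ⟨μ x, hinv₁ x⟩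
  have hcomm' : ∀ t : ℝ, 0 ≤ t → ∀ x, T t (PP x) = PP (T t x) := fun t ht x =>
    DFunLike.congr_fun (hcomm t ht) x
  have hQ : ∀ x, QQ x = x - PP x := fun x => by simp [hQQ]
  obtain ⟨p, hp, -⟩ := (PP u).exists_smul_of_bounded hβ hM hM0
  obtain ⟨q, hq, -⟩ := (QQ u).exists_smul_of_bounded hβ hM hM0
  have hwpq : w = p + q := by
    ext r
    simp [hw, hp, hq, hQ, smul_sub]
  have hQp : QQ p = 0 := by
    refine eq_zero_of_norm_le_mul_exp_neg (C := N * (M * (N * ‖u‖))) hν fun t ht => ?_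
    have hTp : ‖T t p‖ ≤ M * (N * ‖u‖) := by
      obtain ⟨z, hz, hzn⟩ := (T t (PP u)).exists_smul_of_bounded
        (β := fun r => β (μinv (μ r - t))) (by fun_prop) (fun r => hM _) hM0
      have hzT : T t p = z := by
        ext r
        rw [hT t ht, hz, hT t ht, hp, map_smul]
      rw [hzT]
      refine hzn.trans (mul_le_mul_of_nonneg_left ((hstable t ht u).trans ?_) hM0)
      refine mul_le_mul_of_nonneg_right (mul_le_of_le_one_right (by linarith) ?_) (norm_nonneg _)
      exact Real.exp_le_one_iff.mpr (by nlinarith)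
    calc ‖QQ p‖ ≤ N * Real.exp (-ν * t) * ‖T t p‖ :=
          hunstable t ht _ _ ⟨p, rfl⟩ (by simp only [hQ, map_sub, hcomm' t ht])
      _ ≤ N * Real.exp (-ν * t) * (M * (N * ‖u‖)) :=
          mul_le_mul_of_nonneg_left hTp (by positivity)
      _ = N * (M * (N * ‖u‖)) * Real.exp (-ν * t) := by ring
  have hPq : PP q = 0 := by
    refine eq_zero_of_norm_le_mul_exp_neg (C := N * (M * (N * ‖u‖))) hν fun t ht => ?_
    obtain ⟨v, hv, hTv⟩ := (hbij t ht).surjOn ⟨u, rfl⟩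
    have hvn : ‖v‖ ≤ N * ‖u‖ := by
      refine (hunstable t ht u v hv hTv).trans ?_
      refine mul_le_mul_of_nonneg_right (mul_le_of_le_one_right (by linarith) ?_) (norm_nonneg _)
      exact Real.exp_le_one_iff.mpr (by nlinarith)
    obtain ⟨z, hz, hzn⟩ := v.exists_smul_of_bounded
      (β := fun r => β (μinv (μ r + t))) (by fun_prop) (fun r => hM _) hM0
    have hTz : T t z = q := by
      ext r
      rw [hT t ht, hz, hq, ← hTv, hT t ht, map_smul, hinv₂, sub_add_cancel, hinv₁]
    calc ‖PP q‖ = ‖T t (PP z)‖ := by rw [hcomm' t ht, hTz]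
      _ ≤ N * Real.exp (-ν * t) * ‖z‖ := hstable t ht z
      _ ≤ N * Real.exp (-ν * t) * (M * (N * ‖u‖)) :=
          mul_le_mul_of_nonneg_left (hzn.trans (mul_le_mul_of_nonneg_left hvn hM0)) (by positivity)
      _ = N * (M * (N * ‖u‖)) * Real.exp (-ν * t) := by ring
  have hPp : PP p = p := (sub_eq_zero.mp ((hQ p).symm.trans hQp)).symm
  rw [hwpq, map_add, hPq, hPp, add_zero, hp]
end

section
/- Let X be a Banach space, μ : ℝ → ℝ a continuously differentiable, strictly increasing function with μ(s) → −∞ as s → −∞ and μ(s) → +∞ as s → +∞ (a homeomorphism of ℝ with inverse μ⁻¹), and U an evolution family on X satisfying ‖U(s,τ)‖ ≤ K e^{α(μ(s)−μ(τ))} for all s ≥ τ (α > 0, K ≥ 1). Suppose U admits a μ-exponential dichotomy with projections P(t) such that t ↦ P(t)x is continuous for each x ∈ X, and let Γ be the associated Green function: Γ(t,ξ) = U(t,ξ)P(ξ) for t > ξ and Γ(t,ξ) = −U_Q(t,ξ)Q(ξ) for t < ξ. Then for every f ∈ C₀(ℝ,X), the function u(t) = −∫_ℝ μ′(ξ) Γ(t,ξ)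 f(ξ) dξ is well defined, belongs to C₀(ℝ,X), and satisfies lim_{h→0⁺} (T_h u − u)/h = f in the supremum norm, where T_t is the generalized evolution semigroup; that is, u lies in the domain of the generator G of {T_t} and Gu = f (so that G is surjective with G⁻¹f = u). -/
open Set Filter Topology MeasureTheory
open scoped ZeroAtInfty

section StrongContinuity

variable {Y X : Type*} [TopologicalSpace Y] [NormedAddCommGroup X] [NormedSpace ℝ X]

/-- A strongly continuous, locally bounded family of operators applied to a continuous function
is continuous. -/
theorem continuousOn_clm_apply_of_locally_bounded {A : Y → X →L[ℝ] X} {w : Y → X} {s : Set Y}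
    (hA : ∀ x, ContinuousOn (fun y => A y x) s)
    (hb : ∀ y ∈ s, ∃ C, ∀ᶠ z in 𝓝[s] y, ‖A z‖ ≤ C)
    (hw : ContinuousOn w s) : ContinuousOn (fun y => A y (w y)) s := by
  intro y hy
  obtain ⟨C, hC⟩ := hb y hy
  have h₁ : Tendsto (fun z => A z (w z - w y)) (𝓝[s] y) (𝓝 0) := by
    have h₀ : Tendsto (fun z => C * ‖w z - w y‖) (𝓝[s] y) (𝓝 0) := by
      simpa using ((((hw y hy).tendsto.sub_const (w y)).norm).const_mul C)
    refine squeeze_zero_norm' ?_ h₀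
    filter_upwards [hC] with z hz
    exact (A z).le_of_opNorm_le hz _
  have h₂ := h₁.add (hA (w y) y hy).tendsto
  simpa [ContinuousWithinAt] using h₂

end StrongContinuity

theorem integrable_exp_neg_mul_abs {ν : ℝ} (hν : 0 < ν) :
    Integrable (fun x : ℝ => Real.exp (-ν * |x|)) := by
  rw [← integrableOn_univ, ← Iic_union_Ioi (a := (0 : ℝ))]
  refine IntegrableOn.union ?_ ?_
  · refine (integrableOn_exp_mul_Iic hν 0).congr_fun (fun x hx => ?_) measurableSet_Iic
    simp [abs_of_nonpos (mem_Iic.1 hx)]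
  · refine (integrableOn_exp_mul_Ioi (neg_lt_zero.2 hν) 0).congr_fun (fun x hx => ?_)
      measurableSet_Ioi
    simp [abs_of_pos (mem_Ioi.1 hx)]

/-- An exponentially bounded evolution family `V` together with an exponential dichotomy with
projections `R`; the operator `Z t ξ` (for `t ≤ ξ`) is the inverse of `V ξ t` on the kernels of
the projections, precomposed with `1 - R ξ`. -/
structure ExponentialDichotomy {X : Type*} [NormedAddCommGroup X] [NormedSpace ℝ X]
    (V : ℝ → ℝ → X →L[ℝ] X) (R : ℝ → X →L[ℝ] X) (Z : ℝ → ℝ → X →L[ℝ] X)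
    (K α ν N : ℝ) : Prop where
  refl : ∀ t x, V t t x = x
  trans : ∀ {t τ s : ℝ}, s ≤ τ → τ ≤ t → ∀ x, V t τ (V τ s x) = V t s x
  continuousOn : ∀ x, ContinuousOn (fun p : ℝ × ℝ => V p.1 p.2 x) {p | p.2 ≤ p.1}
  rate_nonneg : 0 ≤ α
  const_nonneg : 0 ≤ K
  norm_le : ∀ {s τ : ℝ}, τ ≤ s → ‖V s τ‖ ≤ K * Real.exp (α * (s - τ))
  proj_continuous : ∀ x, Continuous (fun t => R t x)
  proj_comm : ∀ {s t : ℝ}, s ≤ t → ∀ x, R t (V t s x) = V t s (R s x)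
  proj_inv : ∀ {t ξ : ℝ}, t ≤ ξ → ∀ x, R t (Z t ξ x) = 0
  apply_inv : ∀ {t ξ : ℝ}, t ≤ ξ → ∀ x, V ξ t (Z t ξ x) = x - R ξ x
  inv_apply : ∀ {t ξ : ℝ}, t ≤ ξ → ∀ x, R t x = 0 → Z t ξ (V ξ t x) = x
  inv_continuousOn : ∀ x t, ContinuousOn (fun ξ => Z t ξ x) (Ici t)
  decay_pos : 0 < ν
  norm_stable_le : ∀ {s t : ℝ}, s ≤ t → ‖(V t s).comp (R s)‖ ≤ N * Real.exp (-ν * (t - s))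
  norm_inv_le : ∀ {t ξ : ℝ}, t ≤ ξ → ‖Z t ξ‖ ≤ N * Real.exp (-ν * (ξ - t))

namespace ExponentialDichotomy

variable {X : Type*} [NormedAddCommGroup X] [NormedSpace ℝ X]
  {V : ℝ → ℝ → X →L[ℝ] X} {R : ℝ → X →L[ℝ] X} {Z : ℝ → ℝ → X →L[ℝ] X} {K α ν N : ℝ}

/-- The Green function applied to `g`. -/
noncomputable def green (V : ℝ → ℝ → X →L[ℝ] X) (R : ℝ → X →L[ℝ] X) (Z : ℝ → ℝ → X →L[ℝ] X)
    (g : ℝ → X) (t ξ : ℝ) : X :=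
  if ξ < t then V t ξ (R ξ (g ξ)) else -(Z t ξ (g ξ))

theorem apply_inv_of_le (h : ExponentialDichotomy V R Z K α ν N) {σ s ξ : ℝ} (hσ : σ ≤ s)
    (hξ : s ≤ ξ) (x : X) : V s σ (Z σ ξ x) = Z s ξ x := by
  have h₁ : R s (V s σ (Z σ ξ x)) = 0 := by
    rw [h.proj_comm hσ, h.proj_inv (hσ.trans hξ), map_zero]
  have h₂ := h.inv_apply hξ _ h₁
  rw [h.trans hσ hξ, h.apply_inv (hσ.trans hξ)] at h₂
  have h₃ := h.inv_apply hξ _ (h.proj_inv hξ x)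
  rw [h.apply_inv hξ] at h₃
  exact h₂.symm.trans h₃

theorem apply_inv_of_ge (h : ExponentialDichotomy V R Z K α ν N) {σ s ξ : ℝ} (hσ : σ ≤ ξ)
    (hξ : ξ ≤ s) (x : X) : V s σ (Z σ ξ x) = V s ξ x - V s ξ (R ξ x) := by
  rw [← h.trans hσ hξ, h.apply_inv hσ, map_sub]

theorem apply_green (h : ExponentialDichotomy V R Z K α ν N) (g : ℝ → X) {σ s : ℝ} (hσ : σ ≤ s)
    (ξ : ℝ) : V s σ (green V R Z g σ ξ) =
      green V R Z g s ξ - (Ico σ s).indicator (fun ξ => V s ξ (g ξ)) ξ := by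
  unfold green
  by_cases h₁ : ξ < σ
  · rw [if_pos h₁, if_pos (h₁.trans_le hσ), h.trans h₁.le hσ,
      indicator_of_notMem (fun hm => hm.1.not_gt h₁), sub_zero]
  · by_cases h₂ : ξ < s
    · rw [if_neg h₁, if_pos h₂, indicator_of_mem (mem_Ico.2 ⟨not_lt.1 h₁, h₂⟩), map_neg,
        h.apply_inv_of_ge (not_lt.1 h₁) h₂.le]
      abel
    · rw [if_neg h₁, if_neg h₂, indicator_of_notMem (fun hm => h₂ hm.2), map_neg,
        h.apply_inv_of_le hσ (not_lt.1 h₂), sub_zero]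

theorem norm_green_le (h : ExponentialDichotomy V R Z K α ν N) (g : ℝ → X) (t ξ : ℝ) :
    ‖green V R Z g t ξ‖ ≤ N * Real.exp (-ν * |t - ξ|) * ‖g ξ‖ := by
  unfold green
  split_ifs with hξ
  · rw [abs_of_nonneg (sub_nonneg.2 hξ.le)]
    exact ((V t ξ).comp (R ξ)).le_of_opNorm_le (h.norm_stable_le hξ.le) _
  · rw [norm_neg, abs_sub_comm, abs_of_nonneg (sub_nonneg.2 (not_lt.1 hξ))]
    exact (Z t ξ).le_of_opNorm_le (h.norm_inv_le (not_lt.1 hξ)) _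

theorem nonneg_const (h : ExponentialDichotomy V R Z K α ν N) : 0 ≤ N := by
  simpa using (norm_nonneg _).trans (h.norm_inv_le (le_refl 0))

theorem continuousOn_apply (h : ExponentialDichotomy V R Z K α ν N) {w : ℝ → X}
    (hw : Continuous w) : ContinuousOn (fun p : ℝ × ℝ => V p.1 p.2 (w p.2)) {p | p.2 ≤ p.1} := by
  refine continuousOn_clm_apply_of_locally_bounded (A := fun p : ℝ × ℝ => V p.1 p.2)
    h.continuousOn (fun y _ => ?_) (hw.comp continuous_snd).continuousOn
  have hc : ContinuousAt (fun p : ℝ × ℝ => K * Real.exp (α * (p.1 - p.2))) y := by fun_prop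
  refine ⟨K * Real.exp (α * (y.1 - y.2)) + 1, ?_⟩
  filter_upwards [nhdsWithin_le_nhds (hc.eventually_lt_const (lt_add_one _)),
    self_mem_nhdsWithin] with z hz hzs
  exact (h.norm_le hzs).trans hz.le

theorem continuous_proj_apply (h : ExponentialDichotomy V R Z K α ν N) {w : ℝ → X}
    (hw : Continuous w) : Continuous (fun t => R t (w t)) := by
  rw [← continuousOn_univ]
  refine continuousOn_clm_apply_of_locally_bounded (fun x => (h.proj_continuous x).continuousOn)
    (fun y _ => ⟨N, Eventually.of_forall fun z => ?_⟩) hw.continuousOn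
  have hz := h.norm_stable_le (le_refl z)
  have : (V z z).comp (R z) = R z := ContinuousLinearMap.ext fun x => h.refl z _
  simpa [this] using hz

theorem continuousOn_inv_apply (h : ExponentialDichotomy V R Z K α ν N) {w : ℝ → X}
    (hw : Continuous w) (t : ℝ) : ContinuousOn (fun ξ => Z t ξ (w ξ)) (Ici t) := by
  refine continuousOn_clm_apply_of_locally_bounded (fun x => h.inv_continuousOn x t)
    (fun y _ => ⟨N, ?_⟩) hw.continuousOn
  filter_upwards [self_mem_nhdsWithin] with ξ hξ
  refine (h.norm_inv_le hξ).trans (mul_le_of_le_one_right h.nonneg_const ?_)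
  rw [Real.exp_le_one_iff]
  nlinarith [h.decay_pos, mem_Ici.1 hξ]

theorem aestronglyMeasurable_green (h : ExponentialDichotomy V R Z K α ν N) {g : ℝ → X}
    (hg : Continuous g) (t : ℝ) : AEStronglyMeasurable (green V R Z g t) := by
  have h₁ : ContinuousOn (fun ξ => V t ξ (R ξ (g ξ))) (Iio t) :=
    (h.continuousOn_apply (h.continuous_proj_apply hg)).comp
      (f := fun ξ => (t, ξ)) (by fun_prop) (fun ξ hξ => le_of_lt (mem_Iio.1 hξ))
  have h₂ : ContinuousOn (fun ξ => -(Z t ξ (g ξ))) (Iio t)ᶜ := by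
    rw [compl_Iio]
    exact (h.continuousOn_inv_apply hg t).neg
  have hgreen : green V R Z g t = (Iio t).piecewise (fun ξ => V t ξ (R ξ (g ξ)))
      (fun ξ => -(Z t ξ (g ξ))) := by
    ext ξ
    simp only [green, piecewise, mem_Iio]
  rw [hgreen]
  exact AEStronglyMeasurable.piecewise measurableSet_Iio
    (h₁.aestronglyMeasurable measurableSet_Iio)
    (h₂.aestronglyMeasurable measurableSet_Iio.compl)

theorem integrable_green (h : ExponentialDichotomy V R Z K α ν N) {g : ℝ → X}
    (hg : Continuous g) {B : ℝ} (hB : ∀ t, ‖g t‖ ≤ B) (t : ℝ) :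
    Integrable (green V R Z g t) := by
  refine Integrable.mono' (g := fun ξ => N * Real.exp (-ν * |t - ξ|) * B) ?_
    (h.aestronglyMeasurable_green hg t) (ae_of_all _ fun ξ => (h.norm_green_le g t ξ).trans ?_)
  · exact (((integrable_exp_neg_mul_abs h.decay_pos).comp_sub_left t).const_mul N).mul_const B
  · exact mul_le_mul_of_nonneg_left (hB ξ) (mul_nonneg h.nonneg_const (Real.exp_pos _).le)

/-- `∫ Γ(t,ξ) g(ξ) dξ` tends to zero at infinity if `g` does. -/
theorem tendsto_integral_green (h : ExponentialDichotomy V R Z K α ν N) {g : ℝ → X}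
    (hg : Continuous g) (hg₀ : Tendsto g (cocompact ℝ) (𝓝 0)) {B : ℝ} (hB : ∀ t, ‖g t‖ ≤ B) :
    Tendsto (fun t => -∫ ξ, green V R Z g t ξ) (cocompact ℝ) (𝓝 0) := by
  have : (cocompact ℝ).IsCountablyGenerated := by
    rw [cocompact_eq_atBot_atTop]; infer_instance
  have hlim : Tendsto (fun t => ∫ r, N * Real.exp (-ν * |r|) * ‖g (t - r)‖) (cocompact ℝ)
      (𝓝 (∫ _ : ℝ, (0 : ℝ))) := by
    refine tendsto_integral_filter_of_dominated_convergence
      (fun r => N * Real.exp (-ν * |r|) * B) ?_ ?_ ?_ ?_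
    · refine Eventually.of_forall fun t => Continuous.aestronglyMeasurable (by fun_prop)
    · refine Eventually.of_forall fun t => ae_of_all _ fun r => ?_
      have hnn := mul_nonneg h.nonneg_const (Real.exp_pos (-ν * |r|)).le
      rw [Real.norm_of_nonneg (mul_nonneg hnn (norm_nonneg _))]
      exact mul_le_mul_of_nonneg_left (hB _) hnn
    · exact ((integrable_exp_neg_mul_abs h.decay_pos).const_mul N).mul_const B
    · refine ae_of_all _ fun r => ?_
      have hr : Tendsto (fun t : ℝ => t - r) (cocompact ℝ) (cocompact ℝ) :=
        (Homeomorph.subRight r).isClosedEmbedding.tendsto_cocompact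
      simpa using ((hg₀.comp hr).norm.const_mul (N * Real.exp (-ν * |r|)))
  rw [integral_zero] at hlim
  refine squeeze_zero_norm (fun t => ?_) hlim
  rw [norm_neg]
  refine (norm_integral_le_integral_norm _).trans ?_
  rw [← integral_sub_left_eq_self (fun r => N * Real.exp (-ν * |r|) * ‖g (t - r)‖) volume t]
  refine integral_mono (h.integrable_green hg hB t).norm ?_ (fun ξ => ?_)
  · simp only [sub_sub_cancel]
    refine Integrable.mono' (g := fun ξ => N * Real.exp (-ν * |t - ξ|) * B)
      ((((integrable_exp_neg_mul_abs h.decay_pos).comp_sub_left t).const_mul N).mul_const B)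
      (Continuous.aestronglyMeasurable (by fun_prop)) (ae_of_all _ fun ξ => ?_)
    have hnn := mul_nonneg h.nonneg_const (Real.exp_pos (-ν * |t - ξ|)).le
    rw [Real.norm_of_nonneg (mul_nonneg hnn (norm_nonneg _))]
    exact mul_le_mul_of_nonneg_left (hB _) hnn
  · simpa only [sub_sub_cancel] using h.norm_green_le g t ξ

/-- Joint continuity of the evolution semigroup orbit `(s, r) ↦ V(s, s - r) g(s - r)`. -/
theorem continuous_orbit (h : ExponentialDichotomy V R Z K α ν N) {g : ℝ → X}
    (hg : Continuous g) :
    Continuous (fun p : ℝ × ℝ => V p.1 (p.1 - max p.2 0) (g (p.1 - max p.2 0))) :=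
  (h.continuousOn_apply hg).comp_continuous (f := fun p : ℝ × ℝ => (p.1, p.1 - max p.2 0))
    (by fun_prop) (fun p => by simp)

/-- Strong continuity at zero of the evolution semigroup on functions vanishing at infinity. -/
theorem eventually_norm_orbit_sub_le (h : ExponentialDichotomy V R Z K α ν N) {g : ℝ → X}
    (hg : Continuous g) (hg₀ : Tendsto g (cocompact ℝ) (𝓝 0)) {ε : ℝ} (hε : 0 < ε) :
    ∀ᶠ r in 𝓝 (0 : ℝ), ∀ a, ‖V a (a - max r 0) (g (a - max r 0)) - g a‖ ≤ ε := by
  set C := K * Real.exp α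
  have hC : 0 ≤ C := mul_nonneg h.const_nonneg (Real.exp_pos _).le
  have hη : 0 < ε / (C + 1) := by positivity
  have hsmall : ∀ᶠ t in cocompact ℝ, ‖g t‖ < ε / (C + 1) :=
    (tendsto_zero_iff_norm_tendsto_zero.1 hg₀).eventually_lt_const hη
  rw [cocompact_eq_atBot_atTop, eventually_sup, eventually_atBot, eventually_atTop] at hsmall
  obtain ⟨⟨m, hm⟩, ⟨M, hM⟩⟩ := hsmall
  have hcpt : ∀ᶠ r in 𝓝 (0 : ℝ), ∀ a ∈ Icc m (M + 1),
      ‖V a (a - max r 0) (g (a - max r 0)) - g a‖ ≤ ε := by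
    refine isCompact_Icc.eventually_forall_of_forall_eventually
      (P := fun r a => ‖V a (a - max r 0) (g (a - max r 0)) - g a‖ ≤ ε) (fun a _ => ?_)
    have hc : Continuous (fun z : ℝ × ℝ =>
        ‖V z.2 (z.2 - max z.1 0) (g (z.2 - max z.1 0)) - g z.2‖) :=
      (((h.continuous_orbit hg).comp continuous_swap).sub (hg.comp continuous_snd)).norm
    have h₀ : ‖V a (a - max 0 0) (g (a - max 0 0)) - g a‖ < ε := by simpa [h.refl] using hε
    exact ((hc.tendsto ((0 : ℝ), a)).eventually_lt_const h₀).mono fun _ hz => hz.le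
  filter_upwards [hcpt, eventually_le_nhds (zero_lt_one' ℝ)] with r hr hr1 a
  by_cases ha : a ∈ Icc m (M + 1)
  · exact hr a ha
  have hmax : max r 0 ≤ 1 := max_le hr1 zero_le_one
  have hmax₀ : 0 ≤ max r 0 := le_max_right _ _
  have hlt : ‖g a‖ < ε / (C + 1) ∧ ‖g (a - max r 0)‖ < ε / (C + 1) := by
    rw [mem_Icc, not_and_or, not_le, not_le] at ha
    rcases ha with ha | ha
    · exact ⟨hm _ ha.le, hm _ (by linarith)⟩
    · exact ⟨hM _ (by linarith), hM _ (by linarith)⟩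
  have hV : ‖V a (a - max r 0)‖ ≤ C := by
    refine (h.norm_le (by linarith)).trans (mul_le_mul_of_nonneg_left ?_ h.const_nonneg)
    rw [sub_sub_cancel]
    exact Real.exp_le_exp.2 (mul_le_of_le_one_right h.rate_nonneg hmax)
  calc ‖V a (a - max r 0) (g (a - max r 0)) - g a‖
      ≤ ‖V a (a - max r 0) (g (a - max r 0))‖ + ‖g a‖ := norm_sub_le _ _
    _ ≤ C * (ε / (C + 1)) + ε / (C + 1) :=
        add_le_add (((V a (a - max r 0)).le_of_opNorm_le hV _).trans
          (mul_le_mul_of_nonneg_left hlt.2.le hC)) hlt.1.le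
    _ = ε := by field_simp

variable [CompleteSpace X]

/-- The variation of constants formula for `t ↦ -∫ Γ(t,ξ) g(ξ) dξ`. -/
theorem apply_integral_green (h : ExponentialDichotomy V R Z K α ν N) {g : ℝ → X}
    (hg : Continuous g) {B : ℝ} (hB : ∀ t, ‖g t‖ ≤ B) {σ s : ℝ} (hσ : σ ≤ s) :
    V s σ (-∫ ξ, green V R Z g σ ξ) = (-∫ ξ, green V R Z g s ξ) +
      ∫ r in (0 : ℝ)..(s - σ), V s (s - max r 0) (g (s - max r 0)) := by
  have hint : IntegrableOn (fun ξ => V s ξ (g ξ)) (Ico σ s) := by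
    have hc : ContinuousOn (fun ξ => V s ξ (g ξ)) (Icc σ s) :=
      (h.continuousOn_apply hg).comp (f := fun ξ => (s, ξ)) (by fun_prop) (fun ξ hξ => hξ.2)
    exact hc.integrableOn_Icc.mono_set Ico_subset_Icc_self
  have horb : ∫ r in (0 : ℝ)..(s - σ), V s (s - max r 0) (g (s - max r 0)) =
      ∫ ξ in Ico σ s, V s ξ (g ξ) := by
    have h₁ : ∫ r in (0 : ℝ)..(s - σ), V s (s - max r 0) (g (s - max r 0)) =
        ∫ r in (0 : ℝ)..(s - σ), V s (s - r) (g (s - r)) := by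
      refine intervalIntegral.integral_congr fun r hr => ?_
      rw [uIcc_of_le (sub_nonneg.2 hσ)] at hr
      simp only [max_eq_left hr.1]
    rw [h₁, intervalIntegral.integral_comp_sub_left (fun ξ => V s ξ (g ξ)) s, sub_sub_cancel,
      sub_zero, intervalIntegral.integral_of_le hσ, integral_Ioc_eq_integral_Ioo,
      integral_Ico_eq_integral_Ioo]
  rw [map_neg, ← ContinuousLinearMap.integral_comp_comm _ (h.integrable_green hg hB σ), horb]
  simp_rw [h.apply_green g hσ]
  rw [integral_sub (h.integrable_green hg hB s) (hint.integrable_indicator measurableSet_Ico),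
    integral_indicator measurableSet_Ico]
  abel

theorem continuous_integral_green (h : ExponentialDichotomy V R Z K α ν N) {g : ℝ → X}
    (hg : Continuous g) {B : ℝ} (hB : ∀ t, ‖g t‖ ≤ B) :
    Continuous (fun t => -∫ ξ, green V R Z g t ξ) := by
  rw [continuous_iff_continuousAt]
  intro t
  have h₁ : ContinuousOn (fun s => V s (t - 1) (-∫ ξ, green V R Z g (t - 1) ξ)) (Ici (t - 1)) :=
    (h.continuousOn _).comp (f := fun s => (s, t - 1)) (by fun_prop) (fun s hs => hs)
  have h₂ : Continuous (fun s => ∫ r in (0 : ℝ)..(s - (t - 1)),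
      V s (s - max r 0) (g (s - max r 0))) :=
    intervalIntegral.continuous_parametric_intervalIntegral_of_continuous
      (h.continuous_orbit hg) (by fun_prop)
  have h₃ : ContinuousOn (fun s => -∫ ξ, green V R Z g s ξ) (Ici (t - 1)) :=
    (h₁.sub h₂.continuousOn).congr fun s hs => by
      rw [Pi.sub_apply, h.apply_integral_green hg hB hs, add_sub_cancel_right]
  exact h₃.continuousAt (Ici_mem_nhds (by linarith))

/-- The difference quotients of the evolution semigroup at `v = -∫ Γ(·,ξ) g(ξ) dξ` converge
uniformly to `g`. -/
theorem eventually_norm_quotient_sub_le (h : ExponentialDichotomy V R Z K α ν N) {g : ℝ → X}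
    (hg : Continuous g) (hg₀ : Tendsto g (cocompact ℝ) (𝓝 0)) {B : ℝ} (hB : ∀ t, ‖g t‖ ≤ B)
    {ε : ℝ} (hε : 0 < ε) :
    ∀ᶠ k in 𝓝[>] (0 : ℝ), ∀ a, ‖k⁻¹ • (V a (a - k) (-∫ ξ, green V R Z g (a - k) ξ) -
      (-∫ ξ, green V R Z g a ξ)) - g a‖ ≤ ε := by
  obtain ⟨δ, hδ, hball⟩ := Metric.eventually_nhds_iff.1 (h.eventually_norm_orbit_sub_le hg hg₀ hε)
  filter_upwards [Ioo_mem_nhdsGT hδ] with k hk a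
  have hk₀ : 0 < k := hk.1
  have horb : Continuous (fun r => V a (a - max r 0) (g (a - max r 0))) :=
    (h.continuous_orbit hg).comp (f := fun r => (a, r)) (by fun_prop)
  have hkey : k⁻¹ • (V a (a - k) (-∫ ξ, green V R Z g (a - k) ξ) -
      (-∫ ξ, green V R Z g a ξ)) - g a =
      k⁻¹ • ∫ r in (0 : ℝ)..k, (V a (a - max r 0) (g (a - max r 0)) - g a) := by
    rw [h.apply_integral_green hg hB (by linarith : a - k ≤ a), sub_sub_cancel,
      add_sub_cancel_left, intervalIntegral.integral_sub (horb.intervalIntegrable _ _)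
      intervalIntegrable_const, intervalIntegral.integral_const, sub_zero, smul_sub,
      inv_smul_smul₀ hk₀.ne']
  have hle : ‖∫ r in (0 : ℝ)..k, (V a (a - max r 0) (g (a - max r 0)) - g a)‖ ≤ ε * |k - 0| := by
    refine intervalIntegral.norm_integral_le_of_norm_le_const fun r hr => hball ?_ a
    rw [uIoc_of_le hk₀.le] at hr
    rw [Real.dist_eq, sub_zero, abs_of_pos hr.1]
    exact hr.2.trans_lt hk.2
  rw [hkey, norm_smul, norm_inv, Real.norm_of_nonneg hk₀.le, inv_mul_le_iff₀ hk₀]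
  rwa [sub_zero, abs_of_pos hk₀, mul_comm] at hle

end ExponentialDichotomy

/-- Change of variables along an increasing `C¹` bijection of the line. -/
theorem integrable_and_integral_comp_of_monotone {X : Type*} [NormedAddCommGroup X]
    [NormedSpace ℝ X] {μ : ℝ → ℝ} (hμ : Differentiable ℝ μ) (hm : Monotone μ)
    (hs : Function.Surjective μ) {G : ℝ → X} (hG : Integrable G) :
    Integrable (fun ξ => deriv μ ξ • G (μ ξ)) ∧ ∫ ξ, deriv μ ξ • G (μ ξ) = ∫ a, G a := by
  have hd : ∀ x ∈ univ, HasDerivWithinAt μ (deriv μ x) univ x := fun x _ =>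
    (hμ x).hasDerivAt.hasDerivWithinAt
  constructor
  · have := (integrableOn_image_iff_integrableOn_deriv_smul_of_monotoneOn MeasurableSet.univ hd
      (hm.monotoneOn _) G).1 hG.integrableOn
    rwa [integrableOn_univ] at this
  · have := integral_image_eq_integral_deriv_smul_of_monotoneOn MeasurableSet.univ hd
      (hm.monotoneOn _) G
    rwa [image_univ, hs.range_eq, setIntegral_univ, setIntegral_univ, eq_comm] at this

/-- Suppose `μ` is a continuously differentiable, strictly increasing
homeomorphism of `ℝ` and the evolution family `U` admits a `μ`-exponential dichotomy
with strongly continuous projections `P t` and Green function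
`Γ(t,ξ) = U(t,ξ) P(ξ)` for `t > ξ`, `Γ(t,ξ) = −U_Q(t,ξ) Q(ξ)` for `t < ξ`
(here `W t ξ = U_Q(t,ξ) Q(ξ)` for `t ≤ ξ`). Then for every `f ∈ C₀(ℝ, X)` the function
`u(t) = −∫_ℝ μ′(ξ) Γ(t,ξ) f(ξ) dξ` is well defined, belongs to `C₀(ℝ, X)`, and
satisfies `lim_{h→0⁺} (T_h u − u)/h = f`, i.e. `u ∈ D(G)` and `G u = f`. -/
theorem green_function_inverts_generator
    (X : Type*) [NormedAddCommGroup X] [NormedSpace ℝ X] [CompleteSpace X]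
    (μ μinv : ℝ → ℝ)
    (hμc1 : ContDiff ℝ 1 μ) (hμm : StrictMono μ)
    (hμbot : Tendsto μ atBot atBot) (hμtop : Tendsto μ atTop atTop)
    (hinv₁ : ∀ s : ℝ, μinv (μ s) = s) (hinv₂ : ∀ s : ℝ, μ (μinv s) = s)
    (U : ℝ → ℝ → (X →L[ℝ] X))
    (hU1 : ∀ t : ℝ, U t t = ContinuousLinearMap.id ℝ X)
    (hU2 : ∀ t τ s : ℝ, s ≤ τ → τ ≤ t → (U t τ).comp (U τ s) = U t s)
    (hU3 : ∀ x : X, ContinuousOn (fun p : ℝ × ℝ => U p.1 p.2 x) {p : ℝ × ℝ | p.2 ≤ p.1})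
    (K α : ℝ) (hα : 0 < α) (hK : 1 ≤ K)
    (hbound : ∀ s τ : ℝ, τ ≤ s → ‖U s τ‖ ≤ K * Real.exp (α * (μ s - μ τ)))
    -- the generalized evolution semigroup
    (T : ℝ → (C₀(ℝ, X) →L[ℝ] C₀(ℝ, X)))
    (hT : ∀ t : ℝ, 0 ≤ t → ∀ w : C₀(ℝ, X), ∀ s : ℝ,
      T t w s = U s (μinv (μ s - t)) (w (μinv (μ s - t))))
    -- the `μ`-exponential dichotomy with projections `P t`, `Q t = Id − P t`,
    -- and `W t ξ = U_Q(t,ξ) Q(ξ)` (for `t ≤ ξ`) the inverse part of the Green function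
    (P Q : ℝ → (X →L[ℝ] X))
    (hQ : ∀ t : ℝ, Q t = ContinuousLinearMap.id ℝ X - P t)
    (hPproj : ∀ t : ℝ, (P t).comp (P t) = P t)
    (hPcont : ∀ x : X, Continuous (fun t : ℝ => P t x))
    (hPcompat : ∀ s t : ℝ, s ≤ t → (P t).comp (U t s) = (U t s).comp (P s))
    (W : ℝ → ℝ → (X →L[ℝ] X))
    (hWrange : ∀ t ξ : ℝ, t ≤ ξ → ∀ x : X, W t ξ x ∈ Set.range (Q t))
    (hWinv₁ : ∀ t ξ : ℝ, t ≤ ξ → (U ξ t).comp (W t ξ) = Q ξ)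
    (hWinv₂ : ∀ t ξ : ℝ, t ≤ ξ → ∀ y : X, y ∈ Set.range (Q t) → W t ξ (U ξ t y) = y)
    (hWcont : ∀ x : X, ∀ t : ℝ, ContinuousOn (fun ξ : ℝ => W t ξ x) (Set.Ici t))
    (ν N : ℝ) (hν : 0 < ν) (hN : 1 ≤ N)
    (hdich₁ : ∀ s t : ℝ, s ≤ t →
      ‖(U t s).comp (P s)‖ ≤ N * Real.exp (-ν * (μ t - μ s)))
    (hdich₂ : ∀ t ξ : ℝ, t ≤ ξ → ‖W t ξ‖ ≤ N * Real.exp (-ν * (μ ξ - μ t)))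
    (f : C₀(ℝ, X)) :
    (∀ t : ℝ, Integrable (fun ξ : ℝ =>
      deriv μ ξ • (if ξ < t then U t ξ (P ξ (f ξ)) else -(W t ξ (f ξ))))) ∧
    ∃ u : C₀(ℝ, X),
      (∀ t : ℝ, u t = -∫ ξ : ℝ,
        deriv μ ξ • (if ξ < t then U t ξ (P ξ (f ξ)) else -(W t ξ (f ξ)))) ∧
      Tendsto (fun h : ℝ => h⁻¹ • (T h u - u)) (𝓝[>] (0 : ℝ)) (𝓝 (f : C₀(ℝ, X))) := by
  let e : ℝ ≃o ℝ := hμm.orderIsoOfRightInverse μ μinv hinv₂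
  have hc : Continuous μinv := e.symm.continuous
  have hmono : ∀ {a b : ℝ}, a ≤ b → μinv a ≤ μinv b := fun hab => e.symm.monotone hab
  have hQmem : ∀ t y, y ∈ Set.range (Q t) ↔ P t y = 0 := by
    intro t y
    constructor
    · rintro ⟨x, rfl⟩
      have hx : P t (P t x) = P t x := DFunLike.congr_fun (hPproj t) x
      simp [hQ, hx]
    · intro hy
      exact ⟨y, by simp [hQ, hy]⟩
  let V : ℝ → ℝ → X →L[ℝ] X := fun a b => U (μinv a) (μinv b)
  let R : ℝ → X →L[ℝ] X := fun a => P (μinv a)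
  let Z : ℝ → ℝ → X →L[ℝ] X := fun a b => W (μinv a) (μinv b)
  let g : ℝ → X := fun a => f (μinv a)
  have h : ExponentialDichotomy V R Z K α ν N :=
    { refl := fun t x => by simp [V, hU1]
      trans := fun hs ht x => DFunLike.congr_fun (hU2 _ _ _ (hmono hs) (hmono ht)) x
      continuousOn := fun x => (hU3 x).comp (f := fun p : ℝ × ℝ => (μinv p.1, μinv p.2))
        (by fun_prop) (fun p hp => hmono hp)
      rate_nonneg := hα.le
      const_nonneg := zero_le_one.trans hK
      norm_le := fun hs => by simpa only [hinv₂] using hbound _ _ (hmono hs)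
      proj_continuous := fun x => (hPcont x).comp hc
      proj_comm := fun hs x => DFunLike.congr_fun (hPcompat _ _ (hmono hs)) x
      proj_inv := fun ht x => (hQmem _ _).1 (hWrange _ _ (hmono ht) x)
      apply_inv := fun {t ξ} ht x => by
        have := DFunLike.congr_fun (hWinv₁ _ _ (hmono ht)) x
        simpa [hQ] using this
      inv_apply := fun ht x hx => hWinv₂ _ _ (hmono ht) x ((hQmem _ _).2 hx)
      inv_continuousOn := fun x t => (hWcont x (μinv t)).comp hc.continuousOn
        (fun ξ hξ => hmono hξ)
      decay_pos := hν
      norm_stable_le := fun hs => by simpa only [hinv₂] using hdich₁ _ _ (hmono hs)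
      norm_inv_le := fun ht => by simpa only [hinv₂] using hdich₂ _ _ (hmono ht) }
  have hg : Continuous g := f.continuous.comp hc
  have hg₀ : Tendsto g (cocompact ℝ) (𝓝 0) :=
    (zero_at_infty f).comp e.symm.toHomeomorph.isClosedEmbedding.tendsto_cocompact
  have hB : ∀ a, ‖g a‖ ≤ ‖f‖ := fun a => f.toBCF.norm_coe_le_norm (μinv a)
  have hgreen : ∀ t ξ, ExponentialDichotomy.green V R Z g (μ t) (μ ξ) =
      if ξ < t then U t ξ (P ξ (f ξ)) else -(W t ξ (f ξ)) := by
    intro t ξ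
    simp only [ExponentialDichotomy.green, V, R, Z, g, hinv₁, hμm.lt_iff_lt]
  have hchange := fun t => integrable_and_integral_comp_of_monotone
    (hμc1.differentiable one_ne_zero) hμm.monotone (fun a => ⟨μinv a, hinv₂ a⟩)
    (h.integrable_green hg hB (μ t))
  simp only [hgreen] at hchange
  let u : C₀(ℝ, X) :=
    { toFun := fun t => -∫ ξ, ExponentialDichotomy.green V R Z g (μ t) ξ
      continuous_toFun := (h.continuous_integral_green hg hB).comp hμc1.continuous
      zero_at_infty' := (h.tendsto_integral_green hg hg₀ hB).comp
        e.toHomeomorph.isClosedEmbedding.tendsto_cocompact }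
  refine ⟨fun t => (hchange t).1, u, fun t => congrArg Neg.neg (hchange t).2.symm, ?_⟩
  rw [Metric.tendsto_nhds]
  intro ε hε
  filter_upwards [h.eventually_norm_quotient_sub_le hg hg₀ hB (half_pos hε), self_mem_nhdsWithin]
    with k hk hk₀
  refine lt_of_le_of_lt ?_ (half_lt_self hε)
  rw [dist_eq_norm, ← ZeroAtInftyContinuousMap.norm_toBCF_eq_norm,
    BoundedContinuousFunction.norm_le (half_pos hε).le]
  intro s
  have hs := hk (μ s)
  have hTs := hT k (le_of_lt hk₀) u s
  have hu : ∀ t, u t = -∫ ξ, ExponentialDichotomy.green V R Z g (μ t) ξ := fun _ => rfl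
  rw [hu, hinv₂] at hTs
  simp only [V, R, Z, g, hinv₁] at hs hTs hu
  change ‖k⁻¹ • (T k u s - u s) - f s‖ ≤ ε / 2
  rw [hTs, hu]
  exact hs
end
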